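/- arXiv:math/9904097 — 4 statements merged into one kernel-verified Lean document; each statement's English description precedes it below -/
import Mathlib

section
/- For every positive integer m, the explicit bound D(m) = 2·((m+2)·38)^(2^(m−1)) works in the existence theorem: for all integers d ≥ 2·((m+2)·38)^(2^(m−1)), all r ≥ 1 and all multiplicities m_1, …, m_r with 1 ≤ m_i ≤ m such that (d+1)(d+2)/2 − Σ_{i=1}^r m_i(m_i+1)/2 ≥ 1, there exist pairwise distinct points P_1, …, P_r ∈ ℙ²(ℂ) and an irreducible homogeneous polynomial F ∈ ℂ[X,Y,Z] of degree d having an ordinary singularity of multiplicity m_i at each P_i and whose zero curve is smooth away from the points P_i. -/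
open MvPolynomial

noncomputable section

abbrev Proj2 := Projectivization ℂ (Fin 3 → ℂ)

/-- The iterated partial derivative operator `∂₀^{k 0} ∂₁^{k 1} ∂₂^{k 2}`. -/
def diffOp (k : Fin 3 → ℕ) : MvPolynomial (Fin 3) ℂ →ₗ[ℂ] MvPolynomial (Fin 3) ℂ :=
  (((pderiv (0 : Fin 3)).toLinearMap ^ k 0) * ((pderiv (1 : Fin 3)).toLinearMap ^ k 1) *
    ((pderiv (2 : Fin 3)).toLinearMap ^ k 2) :
    Module.End ℂ (MvPolynomial (Fin 3) ℂ))

/-- Polynomials all of whose partial derivatives of total order `< m` vanish at `p`. -/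
def vanishingSubmodule (m : ℕ) (p : Fin 3 → ℂ) : Submodule ℂ (MvPolynomial (Fin 3) ℂ) :=
  ⨅ k ∈ {k : Fin 3 → ℕ | k 0 + k 1 + k 2 < m},
    LinearMap.ker ((aeval p).toLinearMap ∘ₗ diffOp k)

/-- The space of homogeneous polynomials of degree `d` vanishing to order at least `mi i`
at the point `P i`, for each `i`. -/
def Lspace (d : ℕ) {r : ℕ} (P : Fin r → Proj2) (mi : Fin r → ℕ) :
    Submodule ℂ (MvPolynomial (Fin 3) ℂ) :=
  homogeneousSubmodule (Fin 3) ℂ d ⊓ ⨅ i, vanishingSubmodule (mi i) (P i).rep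

/-- The Zariski topology on a complex vector space: generated by the nonvanishing loci of
polynomial functions (polynomials in finitely many linear forms). -/
def vectorZariski (V : Type*) [AddCommGroup V] [Module ℂ V] : TopologicalSpace V :=
  TopologicalSpace.generateFrom
    { U | ∃ (n : ℕ) (f : MvPolynomial (Fin n) ℂ) (φ : Fin n → (V →ₗ[ℂ] ℂ)),
        U = {v | MvPolynomial.eval (fun i => φ i v) f ≠ 0} }

/-- The Zariski topology on the space of `r`-tuples of points of `ℙ²(ℂ)`, obtained as the
quotient topology from the Zariski topology on tuples of nonzero vectors in `ℂ³`. -/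
def projTupleZariski (r : ℕ) : TopologicalSpace (Fin r → Proj2) :=
  TopologicalSpace.coinduced
    (fun v : {v : Fin r → Fin 3 → ℂ // ∀ i, v i ≠ 0} =>
      fun i => Projectivization.mk ℂ (v.1 i) (v.2 i))
    (TopologicalSpace.induced Subtype.val (vectorZariski (Fin r → Fin 3 → ℂ)))

/-- The Zariski topology on the projectivization of a complex vector space. -/
def projZariski (V : Type*) [AddCommGroup V] [Module ℂ V] :
    TopologicalSpace (Projectivization ℂ V) :=
  TopologicalSpace.coinduced
    (fun v : {v : V // v ≠ 0} => Projectivization.mk ℂ v.1 v.2)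
    (TopologicalSpace.induced Subtype.val (vectorZariski V))

/-- The dehomogenization of `F` in the affine chart `(x, y) ↦ A ⬝ (x, y, 1)`. -/
def chartPoly (A : Matrix (Fin 3) (Fin 3) ℂ) (F : MvPolynomial (Fin 3) ℂ) :
    MvPolynomial (Fin 2) ℂ :=
  aeval (fun j : Fin 3 => ∑ i : Fin 3, C (A j i) * ![X 0, X 1, (1 : MvPolynomial (Fin 2) ℂ)] i) F

/-- `F` has an ordinary singularity of multiplicity `m` at `P`: in some affine chart centered
at `P`, the lowest-degree homogeneous part of the dehomogenization of `F` has degree exactly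
`m` and is a squarefree binary form. -/
def HasOrdinarySingularity (m : ℕ) (P : Proj2) (F : MvPolynomial (Fin 3) ℂ) : Prop :=
  ∃ A : Matrix (Fin 3) (Fin 3) ℂ, IsUnit A.det ∧
    ∃ h : A.mulVec ![0, 0, 1] ≠ 0,
      Projectivization.mk ℂ (A.mulVec ![0, 0, 1]) h = P ∧
      (∀ k < m, homogeneousComponent k (chartPoly A F) = 0) ∧
      homogeneousComponent m (chartPoly A F) ≠ 0 ∧
      Squarefree (homogeneousComponent m (chartPoly A F))

/-- The curve `{F = 0}` is smooth away from the points `P i`: at every point of the curve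
other than the `P i`, some first partial derivative of `F` is nonzero. -/
def SmoothAwayFrom {r : ℕ} (F : MvPolynomial (Fin 3) ℂ) (P : Fin r → Proj2) : Prop :=
  ∀ Q : Proj2, eval Q.rep F = 0 → (∀ i, Q ≠ P i) →
    ∃ j : Fin 3, eval Q.rep (pderiv j F) ≠ 0

/-- The change of coordinates moving `p` to the origin. -/
def shift (p : Fin 2 → ℂ) : MvPolynomial (Fin 2) ℂ →ₐ[ℂ] MvPolynomial (Fin 2) ℂ :=
  aeval (fun j => X j + C (p j))

/-- The ideal of polynomials vanishing to order at least `m` at `p`. -/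
def fatIdeal (p : Fin 2 → ℂ) (m : ℕ) : Ideal (MvPolynomial (Fin 2) ℂ) :=
  (idealOfVars (Fin 2) ℂ ^ m).comap (shift p)

lemma mem_fatIdeal {p : Fin 2 → ℂ} {m : ℕ} {f : MvPolynomial (Fin 2) ℂ} :
    f ∈ fatIdeal p m ↔ shift p f ∈ idealOfVars (Fin 2) ℂ ^ m := Iff.rfl

lemma shift_X (p : Fin 2 → ℂ) (j : Fin 2) : shift p (X j) = X j + C (p j) := by
  simp [shift]

lemma shift_neg_shift (p : Fin 2 → ℂ) (f : MvPolynomial (Fin 2) ℂ) :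
    shift (-p) (shift p f) = f := by
  have : (shift (-p)).comp (shift p) = AlgHom.id ℂ _ := by
    ext j : 1
    simp [shift]
  exact DFunLike.congr_fun this f

lemma shift_shift_neg (p : Fin 2 → ℂ) (f : MvPolynomial (Fin 2) ℂ) :
    shift p (shift (-p) f) = f := by
  simpa using shift_neg_shift (-p) f

lemma eval_shift (p v : Fin 2 → ℂ) (f : MvPolynomial (Fin 2) ℂ) :
    eval v (shift p f) = eval (v + p) f := by
  have : (aeval v).comp (shift p) = (aeval (v + p) : MvPolynomial (Fin 2) ℂ →ₐ[ℂ] ℂ) := by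
    ext j : 1
    simp [shift]
  simpa [aeval_eq_eval] using DFunLike.congr_fun this f

lemma totalDegree_aeval_le {σ τ : Type*} (g : σ → MvPolynomial τ ℂ)
    (hg : ∀ j, (g j).totalDegree ≤ 1) (f : MvPolynomial σ ℂ) :
    (aeval g f).totalDegree ≤ f.totalDegree := by
  classical
  rw [aeval_def, eval₂_eq]
  refine (totalDegree_finsetSum _ _).trans (Finset.sup_le fun s hs => ?_)
  refine (totalDegree_mul _ _).trans ?_
  rw [algebraMap_eq, totalDegree_C, zero_add]
  refine (totalDegree_finsetProd _ _).trans ?_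
  refine le_trans (Finset.sum_le_sum fun i _ => (totalDegree_pow _ _).trans
    (Nat.mul_le_mul_left _ (hg i))) ?_
  simpa [Finsupp.sum] using le_totalDegree hs

lemma totalDegree_shift_le (p : Fin 2 → ℂ) (f : MvPolynomial (Fin 2) ℂ) :
    (shift p f).totalDegree ≤ f.totalDegree := by
  refine totalDegree_aeval_le _ (fun j => ?_) f
  refine (totalDegree_add _ _).trans ?_
  simp

lemma fatIdeal_anti (p : Fin 2 → ℂ) {m n : ℕ} (h : m ≤ n) : fatIdeal p n ≤ fatIdeal p m :=
  Ideal.comap_mono (Ideal.pow_le_pow_right h)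

lemma mul_mem_fatIdeal {p : Fin 2 → ℂ} {m n k : ℕ} {f g : MvPolynomial (Fin 2) ℂ}
    (hf : f ∈ fatIdeal p m) (hg : g ∈ fatIdeal p n) (h : k ≤ m + n) : f * g ∈ fatIdeal p k := by
  refine fatIdeal_anti p h ?_
  rw [mem_fatIdeal, map_mul, pow_add]
  exact Ideal.mul_mem_mul hf hg

lemma mem_fatIdeal_one {p : Fin 2 → ℂ} {f : MvPolynomial (Fin 2) ℂ} :
    f ∈ fatIdeal p 1 ↔ eval p f = 0 := by
  have h : eval p f = coeff 0 (shift p f) := by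
    rw [← constantCoeff_eq, ← eval_zero, eval_shift, zero_add]
  rw [mem_fatIdeal, mem_pow_idealOfVars_iff', h]
  constructor
  · intro h; exact h 0 (by simp)
  · intro h s hs
    have : s = 0 := by
      rwa [Nat.lt_one_iff, Finsupp.degree_eq_zero_iff] at hs
    rw [this, h]

lemma pow_mem_fatIdeal {p : Fin 2 → ℂ} {f : MvPolynomial (Fin 2) ℂ} (hf : eval p f = 0) (m : ℕ) :
    f ^ m ∈ fatIdeal p m := by
  rw [mem_fatIdeal, map_pow]
  have := mem_fatIdeal_one.2 hf
  rw [mem_fatIdeal, pow_one] at this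
  exact Ideal.pow_mem_pow this m

lemma fatIdeal_succ_induction {p : Fin 2 → ℂ} {m : ℕ} {φ : MvPolynomial (Fin 2) ℂ}
    (hφ : φ ∈ fatIdeal p (m + 1)) {motive : MvPolynomial (Fin 2) ℂ → Prop}
    (hmul : ∀ a ∈ fatIdeal p m, ∀ b ∈ fatIdeal p 1, motive (a * b))
    (hadd : ∀ a b, motive a → motive b → motive (a + b)) : motive φ := by
  rw [mem_fatIdeal, pow_succ] at hφ
  rw [← shift_neg_shift p φ]
  refine Submodule.mul_induction_on (C := fun x => motive (shift (-p) x)) hφ ?_ ?_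
  · intro a ha b hb
    rw [map_mul]
    refine hmul _ ?_ _ ?_
    · rwa [mem_fatIdeal, shift_shift_neg]
    · rwa [mem_fatIdeal, shift_shift_neg, pow_one]
  · intro a b ha hb
    rw [map_add]
    exact hadd _ _ ha hb

/-- A polynomial not vanishing at `p` is a unit modulo every power of the ideal of `p`. -/
lemma exists_inverse_mod_fatIdeal {p : Fin 2 → ℂ} {f : MvPolynomial (Fin 2) ℂ}
    (hf : eval p f ≠ 0) (m : ℕ) : ∃ f', f * f' - 1 ∈ fatIdeal p m := by
  set c := eval p f with hc
  set x : MvPolynomial (Fin 2) ℂ := 1 - C c⁻¹ * f with hx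
  have hx1 : eval p x = 0 := by simp [hx, ← hc, hf]
  refine ⟨C c⁻¹ * ∑ i ∈ Finset.range m, x ^ i, ?_⟩
  have h := mul_neg_geom_sum x m
  have : f * (C c⁻¹ * ∑ i ∈ Finset.range m, x ^ i) - 1 = - x ^ m := by
    have h2 : (1 - x) = C c⁻¹ * f := by rw [hx]; ring
    rw [h2] at h
    linear_combination h
  rw [this]
  exact neg_mem (pow_mem_fatIdeal hx1 m)

/-- Taylor truncation at `p`. -/
lemma exists_truncation (p : Fin 2 → ℂ) (m : ℕ) (f : MvPolynomial (Fin 2) ℂ) :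
    ∃ q : MvPolynomial (Fin 2) ℂ, q.totalDegree ≤ m ∧ q - f ∈ fatIdeal p (m + 1) := by
  classical
  set g := shift p f
  refine ⟨shift (-p) (∑ k ∈ Finset.range (m + 1), homogeneousComponent k g), ?_, ?_⟩
  · refine (totalDegree_shift_le _ _).trans ?_
    refine (totalDegree_finsetSum _ _).trans (Finset.sup_le fun k hk => ?_)
    refine (homogeneousComponent_isHomogeneous k g).totalDegree_le.trans ?_
    simpa [Nat.lt_succ_iff] using hk
  · rw [mem_fatIdeal, map_sub, shift_shift_neg, mem_pow_idealOfVars_iff']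
    intro s hs
    rw [coeff_sub, coeff_sum]
    simp only [coeff_homogeneousComponent]
    rw [Finset.sum_ite_eq, if_pos (by simpa using hs)]
    exact sub_self _

/-- Elements of `I` of degree at most `e` realize all jets of order `μ i` at the points `P i`. -/
def Interpolates {ι : Type*} (I : Ideal (MvPolynomial (Fin 2) ℂ)) (e : ℕ) (S : Finset ι)
    (P : ι → Fin 2 → ℂ) (μ : ι → ℕ) : Prop :=
  ∀ t : ι → MvPolynomial (Fin 2) ℂ, ∃ w ∈ I, w.totalDegree ≤ e ∧
    ∀ i ∈ S, w - t i ∈ fatIdeal (P i) (μ i)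

lemma sum_range_succ_eq (n : ℕ) : ∑ k ∈ Finset.range n, (k + 1) = n * (n + 1) / 2 := by
  have h := Finset.sum_range_id_mul_two (n + 1)
  rw [Finset.sum_range_succ'] at h
  simp only [add_zero, Nat.add_sub_cancel] at h
  rw [mul_comm n, ← h, Nat.mul_div_cancel _ two_pos]

lemma exists_ne_zero_vanishing {ι τ : Type*} [Fintype τ] {I : Ideal (MvPolynomial (Fin 2) ℂ)}
    {c : ℕ} (v : τ → MvPolynomial (Fin 2) ℂ) (hv : LinearIndependent ℂ v) (hI : ∀ j, v j ∈ I)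
    (hc : ∀ j, (v j).totalDegree ≤ c) (S : Finset ι) (P : ι → Fin 2 → ℂ) (μ : ι → ℕ)
    (hcard : ∑ i ∈ S, μ i * (μ i + 1) / 2 < Fintype.card τ) :
    ∃ u ≠ 0, u ∈ I ∧ u.totalDegree ≤ c ∧ ∀ i ∈ S, u ∈ fatIdeal (P i) (μ i) := by
  classical
  let κ : Finset (Σ _ : ι, Σ _ : ℕ, ℕ) :=
    S.sigma fun i => (Finset.range (μ i)).sigma fun k => Finset.range (k + 1)
  let L : (τ → ℂ) →ₗ[ℂ] MvPolynomial (Fin 2) ℂ := Fintype.linearCombination ℂ v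
  let T : (τ → ℂ) →ₗ[ℂ] (κ → ℂ) := LinearMap.pi fun x =>
    (lcoeff ℂ (Finsupp.single 0 x.1.2.2 + Finsupp.single 1 (x.1.2.1 - x.1.2.2))) ∘ₗ
      (shift (P x.1.1)).toLinearMap ∘ₗ L
  have hκ : κ.card = ∑ i ∈ S, μ i * (μ i + 1) / 2 := by
    simp only [κ, Finset.card_sigma, Finset.card_range, sum_range_succ_eq]
  obtain ⟨x, hx, hx0⟩ := (Submodule.ne_bot_iff _).1
    (LinearMap.ker_ne_bot_of_finrank_lt (f := T) (by simpa [hκ] using hcard))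
  have hLx : L x = ∑ j, x j • v j := Fintype.linearCombination_apply ..
  refine ⟨L x, ?_, ?_, ?_, ?_⟩
  · intro h0
    refine hx0 (funext fun j => ?_)
    exact Fintype.linearIndependent_iff.1 hv x (hLx ▸ h0) j
  · rw [hLx]
    exact Ideal.sum_mem _ fun j _ => by
      rw [smul_eq_C_mul]; exact Ideal.mul_mem_left _ _ (hI j)
  · rw [hLx]
    exact (totalDegree_finsetSum _ _).trans
      (Finset.sup_le fun j _ => (totalDegree_smul_le _ _).trans (hc j))
  · intro i hi
    rw [mem_fatIdeal, mem_pow_idealOfVars_iff']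
    intro s hs
    have hdeg : s.degree = s 0 + s 1 := by simp [Finsupp.degree_eq_sum]
    have hmem : (⟨i, ⟨s.degree, s 0⟩⟩ : Σ _ : ι, Σ _ : ℕ, ℕ) ∈ κ := by
      simp only [κ, Finset.mem_sigma, Finset.mem_range]
      exact ⟨hi, hs, by omega⟩
    have h : coeff (Finsupp.single 0 (s 0) + Finsupp.single 1 (s.degree - s 0))
        (shift (P i) (L x)) = 0 := congrFun (LinearMap.mem_ker.1 hx) ⟨_, hmem⟩
    have hs' : Finsupp.single (0 : Fin 2) (s 0) + Finsupp.single 1 (s.degree - s 0) = s := by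
      ext j
      fin_cases j
      · simp
      · simp [hdeg]
    rwa [hs'] at h

lemma exists_eval_ne_zero {u : MvPolynomial (Fin 2) ℂ} (hu : u ≠ 0) : ∃ p, eval p u ≠ 0 := by
  by_contra! h
  exact hu (MvPolynomial.funext fun x => by simpa using h x)

/-- If the conditions imposed by the points are fewer than the dimension of the part of `I` of
degree at most `c`, then general points impose independent conditions in degree
`e ≥ c + max μ - 1`. -/
theorem exists_interpolating_points {ι τ : Type*} [Fintype τ]
    {I : Ideal (MvPolynomial (Fin 2) ℂ)} {c e m : ℕ} (v : τ → MvPolynomial (Fin 2) ℂ)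
    (hv : LinearIndependent ℂ v) (hI : ∀ j, v j ∈ I) (hc : ∀ j, (v j).totalDegree ≤ c)
    (hce : c + m ≤ e + 1) (μ : ι → ℕ) (S : Finset ι) (hμ : ∀ i ∈ S, 1 ≤ μ i ∧ μ i ≤ m)
    (hcard : ∑ i ∈ S, μ i * (μ i + 1) / 2 < Fintype.card τ) :
    ∃ P : ι → Fin 2 → ℂ, Interpolates I e S P μ ∧ Set.InjOn P S ∧
      ∀ i ∈ S, ∃ u ∈ I, eval (P i) u ≠ 0 := by
  classical
  induction S using Finset.induction_on with
  | empty => exact ⟨0, fun t => ⟨0, I.zero_mem, by simp, by simp⟩, by simp, by simp⟩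
  | insert a S ha ih =>
    rw [Finset.sum_insert ha] at hcard
    obtain ⟨P, hP, hinj, hu⟩ := ih (fun i hi => hμ i (Finset.mem_insert_of_mem hi))
      ((Nat.le_add_left _ _).trans_lt hcard)
    obtain ⟨u, hu0, huI, hdeg, hvan⟩ := exists_ne_zero_vanishing v hv hI hc S P μ
      ((Nat.le_add_left _ _).trans_lt hcard)
    obtain ⟨p, hp⟩ := exists_eval_ne_zero hu0
    have hne : ∀ i ∈ S, i ≠ a := fun i hi h => ha (h ▸ hi)
    have hupd : ∀ i ∈ S, Function.update P a p i = P i := fun i hi =>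
      Function.update_of_ne (hne i hi) _ _
    have hpne : ∀ i ∈ S, P i ≠ p := by
      intro i hi h
      have h1 := fatIdeal_anti _ (hμ i (Finset.mem_insert_of_mem hi)).1 (hvan i hi)
      rw [mem_fatIdeal_one, h] at h1
      exact hp h1
    have hμa := hμ a (Finset.mem_insert_self _ _)
    refine ⟨Function.update P a p, ?_, ?_, ?_⟩
    · intro t
      obtain ⟨w, hwI, hwd, hw⟩ := hP t
      obtain ⟨u', hu'⟩ := exists_inverse_mod_fatIdeal hp (μ a)
      obtain ⟨q, hqd, hq⟩ := exists_truncation p (μ a - 1) (u' * (t a - w))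
      rw [Nat.sub_add_cancel hμa.1] at hq
      refine ⟨w + u * q, I.add_mem hwI (I.mul_mem_right _ huI), ?_, ?_⟩
      · refine (totalDegree_add _ _).trans (max_le hwd ((totalDegree_mul _ _).trans ?_))
        omega
      · intro i hi
        rcases Finset.mem_insert.1 hi with rfl | hi
        · rw [Function.update_self]
          have : w + u * q - t i = u * (q - u' * (t i - w)) + (u * u' - 1) * (t i - w) := by ring
          rw [this]
          exact Ideal.add_mem _ (Ideal.mul_mem_left _ _ hq) (Ideal.mul_mem_right _ _ hu')
        · rw [hupd i hi]
          have : w + u * q - t i = (w - t i) + u * q := by ring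
          rw [this]
          exact Ideal.add_mem _ (hw i hi) (Ideal.mul_mem_right _ _ (hvan i hi))
    · rw [Finset.coe_insert, Set.injOn_insert (by simpa using ha)]
      refine ⟨?_, ?_⟩
      · intro i hi j hj hij
        rw [hupd i hi, hupd j hj] at hij
        exact hinj hi hj hij
      · rw [Function.update_self]
        rintro ⟨i, hi, h⟩
        rw [hupd i hi] at h
        exact hpne i hi h
    · intro i hi
      rcases Finset.mem_insert.1 hi with rfl | hi
      · exact ⟨u, huI, by rwa [Function.update_self]⟩
      · rw [hupd i hi]
        exact hu i hi

lemma card_le_of_mem_adjoin {K : Subfield ℂ} {ι : Type*} [Fintype ι] {x : ι → ℂ}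
    (hx : AlgebraicIndependent K x) (Y : Finset ℂ)
    (h : ∀ j, x j ∈ IntermediateField.adjoin K (Y : Set ℂ)) : Fintype.card ι ≤ Y.card := by
  classical
  let M := AlgebraicIndependent.matroid K ℂ
  have hind : M.Indep (Set.range x) :=
    AlgebraicIndependent.matroid_indep_iff.2 hx.to_subtype_range
  have hsub : Set.range x ⊆ M.closure Y := by
    rintro _ ⟨j, rfl⟩
    rw [AlgebraicIndependent.matroid_closure_eq]
    rw [SetLike.mem_coe, Subalgebra.mem_algebraicClosure]
    have := IntermediateField.mem_adjoin_iff_div.1 (h j)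
    obtain ⟨a, ha, b, hb, hab⟩ := this
    rw [hab, div_eq_mul_inv]
    exact (isAlgebraic_algebraMap (⟨a, ha⟩ : Algebra.adjoin K (Y : Set ℂ))).mul
      (isAlgebraic_algebraMap (⟨b, hb⟩ : Algebra.adjoin K (Y : Set ℂ))).inv
  have h1 := hind.encard_le_eRk_of_subset hsub
  rw [Matroid.eRk_closure_eq] at h1
  have h2 := h1.trans (M.eRk_le_encard _)
  have h3 : (Set.range x).encard = Fintype.card ι := by
    rw [← Set.image_univ, hx.injective.encard_image, Set.encard_univ, ENat.card_eq_coe_fintype_card]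
  rw [h3, Set.encard_coe_eq_coe_finsetCard] at h2
  exact_mod_cast h2

/-- Algebraically independent numbers do not satisfy more independent linear equations than
the number of parameters on which the coefficients depend. -/
theorem not_linear_system {K : Subfield ℂ} {ι : Type*} [Fintype ι] {x : ι → ℂ}
    (hx : AlgebraicIndependent K x) {c : ℕ} (Y : Finset ℂ) (hY : Y.card ≤ c)
    (α : Fin (c + 1) → ι → ℂ) (β : Fin (c + 1) → ℂ)
    (hα : ∀ k j, α k j ∈ IntermediateField.adjoin K (Y : Set ℂ))
    (hβ : ∀ k, β k ∈ IntermediateField.adjoin K (Y : Set ℂ))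
    (hind : LinearIndependent ℂ α) : ¬ ∀ k, ∑ j, α k j * x j + β k = 0 := by
  classical
  intro heq
  let E := IntermediateField.adjoin K (Y : Set ℂ)
  let v : Option ι → ℂ := fun o => o.elim 1 x
  let Φ : (Option ι → E) →ₗ[E] ℂ := Fintype.linearCombination E v
  let w : Fin (c + 1) → Option ι → E := fun k o => o.elim ⟨β k, hβ k⟩ fun j => ⟨α k j, hα k j⟩
  have hwker : ∀ k, w k ∈ LinearMap.ker Φ := by
    intro k
    rw [LinearMap.mem_ker, Fintype.linearCombination_apply, Fintype.sum_option, ← heq k, add_comm]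
    simp [w, v, Algebra.smul_def]
  have hwind : LinearIndependent E w := by
    rw [Fintype.linearIndependent_iff] at hind ⊢
    intro g hg k
    have := hind (fun k => (g k : ℂ)) (by
      ext j
      have := congrArg (Subtype.val) (congrFun hg (some j))
      simpa [w] using this) k
    exact_mod_cast this
  have hker : c + 1 ≤ Module.finrank E (LinearMap.ker Φ) := by
    have : LinearIndependent E (fun k => (⟨w k, hwker k⟩ : LinearMap.ker Φ)) :=
      LinearIndependent.of_comp (LinearMap.ker Φ).subtype (by exact hwind)
    simpa using this.fintype_card_le_finrank
  have hrn := LinearMap.finrank_range_add_finrank_ker Φ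
  rw [Module.finrank_pi, Fintype.card_option] at hrn
  obtain ⟨b, -, hb0, hbspan, hbind⟩ := exists_linearIndepOn_extension (K := E) (v := v)
    (s := {none}) (t := Set.univ) (by simp [v]) (Set.subset_univ _)
  have hbcard : b.toFinset.card ≤ Module.finrank E (LinearMap.range Φ) := by
    have hmem : ∀ o, v o ∈ LinearMap.range Φ := fun o =>
      ⟨Pi.single o 1, by simp [Φ, Fintype.linearCombination_apply_single]⟩
    have : LinearIndependent E (fun o : b => (⟨v o, hmem o⟩ : LinearMap.range Φ)) :=
      LinearIndependent.of_comp (LinearMap.range Φ).subtype (by exact hbind)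
    simpa using this.fintype_card_le_finrank
  have hb0' : none ∈ b.toFinset := by simpa using hb0
  let Y' : Finset ℂ := Y ∪ (b.toFinset.erase none).image v
  have hY' : Y'.card < Fintype.card ι := by
    have h1 := Finset.card_union_le Y ((b.toFinset.erase none).image v)
    have h2 : ((b.toFinset.erase none).image v).card ≤ (b.toFinset.erase none).card :=
      Finset.card_image_le
    rw [Finset.card_erase_of_mem hb0'] at h2
    have h3 := Finset.card_pos.2 ⟨_, hb0'⟩
    have : Y'.card ≤ Y.card + ((b.toFinset.erase none).image v).card := h1
    omega
  refine absurd (card_le_of_mem_adjoin hx Y' fun j => ?_) (not_le.2 hY')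
  have hEle : E ≤ IntermediateField.adjoin K (Y' : Set ℂ) :=
    IntermediateField.adjoin.mono _ _ _ (by simp [Y'])
  have hmem : x j ∈ Submodule.span E (v '' b) := hbspan ⟨some j, trivial, rfl⟩
  refine Submodule.span_induction (p := fun y _ => y ∈ IntermediateField.adjoin K (Y' : Set ℂ))
    ?_ (zero_mem _) (fun _ _ _ _ => add_mem) (fun a y _ hy => ?_) hmem
  · rintro _ ⟨o, ho, rfl⟩
    cases o with
    | none => exact one_mem _
    | some j =>
      exact IntermediateField.subset_adjoin _ _ (by
        simp only [Y', Finset.coe_union, Finset.coe_image]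
        exact Or.inr ⟨some j, by simpa using ho, rfl⟩)
  · rw [Algebra.smul_def]
    exact mul_mem (hEle a.2) hy

lemma exists_algebraicIndependent (K : Subfield ℂ) (hK : Cardinal.mk K ≤ Cardinal.aleph0)
    (n : ℕ) : ∃ x : Fin n → ℂ, AlgebraicIndependent K x := by
  obtain ⟨s, hs⟩ := exists_isTranscendenceBasis K ℂ
  have h := IsAlgClosed.cardinal_eq_cardinal_transcendence_basis_of_aleph0_lt' _ hs hK
    (by rw [Cardinal.mk_complex]; exact Cardinal.aleph0_lt_continuum)
  have : Infinite s := by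
    rw [Cardinal.infinite_iff, ← h, Cardinal.mk_complex]
    exact Cardinal.aleph0_lt_continuum.le
  exact ⟨_, hs.1.comp _ (Infinite.natEmbedding s |>.injective.comp Fin.val_injective)⟩

lemma exists_countable_subfield (T : Set ℂ) (hT : T.Countable) :
    ∃ K : Subfield ℂ, T ⊆ K ∧ Cardinal.mk K ≤ Cardinal.aleph0 :=
  ⟨Subfield.closure T, Subfield.subset_closure, (Subfield.cardinalMk_closure_le_max T).trans
    (max_le hT.le_aleph0 le_rfl)⟩

lemma eval_mem_of_coeff_mem {L : Subfield ℂ} {σ : Type*} {f : MvPolynomial σ ℂ} {q : σ → ℂ}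
    (hf : ∀ s, coeff s f ∈ L) (hq : ∀ i, q i ∈ L) : eval q f ∈ L := by
  rw [eval_eq]
  exact sum_mem fun s _ => mul_mem (hf s) (prod_mem fun i _ => pow_mem (hq i) _)

/-- A general member of `f₀ + W` imposes no more conditions on a point of the plane than the
number of its parameters, for any countable family of linear operators. -/
theorem exists_general_member (W : Submodule ℂ (MvPolynomial (Fin 2) ℂ)) (hW : W.FG)
    (𝒟 : Set (Module.End ℂ (MvPolynomial (Fin 2) ℂ))) (h𝒟 : 𝒟.Countable)
    (f₀ : MvPolynomial (Fin 2) ℂ) :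
    ∃ w ∈ W, ∀ (c : ℕ) (Y : Finset ℂ) (q : Fin 2 → ℂ)
      (k : Fin (c + 1) → Module.End ℂ (MvPolynomial (Fin 2) ℂ)), Y.card ≤ c →
      (∀ i, q i ∈ Y ∨ q i = 0 ∨ q i = 1) → (∀ l, k l ∈ 𝒟) →
      (∀ l, ∃ u ∈ W, ∀ l', eval q (k l' u) = if l' = l then 1 else 0) →
      ∃ l, eval q (k l (f₀ + w)) ≠ 0 := by
  classical
  obtain ⟨n, g, hg⟩ := Submodule.fg_iff_exists_fin_generating_family.1 hW
  have hgW : ∀ j, g j ∈ W := fun j => hg ▸ Submodule.subset_span ⟨j, rfl⟩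
  obtain ⟨K, hTK, hK⟩ := exists_countable_subfield
    (⋃ D ∈ 𝒟, ⋃ h ∈ insert f₀ (Set.range g), Set.range fun s => coeff s (D h))
    (h𝒟.biUnion fun D _ => ((Set.finite_range g).countable.insert _).biUnion
      fun h _ => Set.countable_range _)
  have hcoeff : ∀ D ∈ 𝒟, ∀ h ∈ insert f₀ (Set.range g), ∀ s, coeff s (D h) ∈ K := by
    intro D hD h hh s
    refine hTK ?_
    simp only [Set.mem_iUnion]
    exact ⟨D, hD, h, hh, s, rfl⟩
  obtain ⟨x, hx⟩ := exists_algebraicIndependent K hK n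
  refine ⟨∑ j, x j • g j, W.sum_mem fun j _ => W.smul_mem _ (hgW j), ?_⟩
  intro c Y q k hY hq hk hsurj
  by_contra! h0
  have hKL : ∀ a ∈ K, a ∈ IntermediateField.adjoin K (Y : Set ℂ) := fun a ha =>
    IntermediateField.algebraMap_mem _ (⟨a, ha⟩ : K)
  have hmem : ∀ l, ∀ h ∈ insert f₀ (Set.range g),
      eval q (k l h) ∈ IntermediateField.adjoin K (Y : Set ℂ) := by
    intro l h hh
    refine eval_mem_of_coeff_mem (L := (IntermediateField.adjoin K (Y : Set ℂ)).toSubfield)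
      (fun s => hKL _ (hcoeff _ (hk l) h hh s)) fun i => ?_
    rcases hq i with h | h | h
    · exact IntermediateField.subset_adjoin _ _ h
    · rw [h]; exact zero_mem _
    · rw [h]; exact one_mem _
  refine not_linear_system hx Y hY (fun l j => eval q (k l (g j))) (fun l => eval q (k l f₀))
    (fun l j => hmem l _ (Or.inr ⟨j, rfl⟩)) (fun l => hmem l _ (Or.inl rfl)) ?_ fun l => ?_
  · rw [Fintype.linearIndependent_iff]
    intro a ha l
    let φ : MvPolynomial (Fin 2) ℂ →ₗ[ℂ] ℂ := ∑ l', a l' • (aeval q).toLinearMap ∘ₗ k l'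
    have hφ : W ≤ LinearMap.ker φ := by
      rw [← hg, Submodule.span_le]
      rintro _ ⟨j, rfl⟩
      have := congrFun ha j
      simpa [φ, aeval_eq_eval] using this
    obtain ⟨u, hu, hul⟩ := hsurj l
    have := LinearMap.mem_ker.1 (hφ hu)
    simpa [φ, aeval_eq_eval, hul] using this
  · have := h0 l
    rw [map_add, map_sum, map_add, map_sum] at this
    rw [← this, add_comm]
    congr 1
    refine Finset.sum_congr rfl fun j _ => ?_
    rw [map_smul, smul_eval, mul_comm]

/-- The homogeneous part of degree `m` of the Taylor expansion at `p`. -/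
def taylorForm (p : Fin 2 → ℂ) (m : ℕ) : Module.End ℂ (MvPolynomial (Fin 2) ℂ) :=
  homogeneousComponent m ∘ₗ (shift p).toLinearMap

lemma taylorForm_apply (p : Fin 2 → ℂ) (m : ℕ) (f : MvPolynomial (Fin 2) ℂ) :
    taylorForm p m f = homogeneousComponent m (shift p f) := rfl

lemma taylorForm_eq_zero {p : Fin 2 → ℂ} {m k : ℕ} {f : MvPolynomial (Fin 2) ℂ}
    (hf : f ∈ fatIdeal p m) (hk : k < m) : taylorForm p k f = 0 := by
  rw [mem_fatIdeal, mem_pow_idealOfVars_iff'] at hf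
  ext s
  rw [taylorForm_apply, coeff_homogeneousComponent, coeff_zero]
  split_ifs with h
  · exact hf s (h ▸ hk)
  · rfl

lemma shift_neg_mem_fatIdeal {p : Fin 2 → ℂ} {m : ℕ} {φ : MvPolynomial (Fin 2) ℂ}
    (hφ : φ.IsHomogeneous m) : shift (-p) φ ∈ fatIdeal p m := by
  rw [mem_fatIdeal, shift_shift_neg, mem_pow_idealOfVars_iff']
  intro s hs
  exact hφ.coeff_eq_zero hs.ne

lemma taylorForm_shift_neg {p : Fin 2 → ℂ} {m : ℕ} {φ : MvPolynomial (Fin 2) ℂ}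
    (hφ : φ.IsHomogeneous m) : taylorForm p m (shift (-p) φ) = φ := by
  rw [taylorForm_apply, shift_shift_neg, homogeneousComponent_of_mem hφ, if_pos rfl]

/-- A linear system of plane curves of degree `d` with prescribed multiplicities contains a
member that is smooth elsewhere in the affine plane and has ordinary singularities, as soon as
it separates first order jets elsewhere and realizes all leading forms. -/
theorem exists_curve_of_jets {ι : Type*} [Finite ι] (P : ι → Fin 2 → ℂ) (μ : ι → ℕ)
    (hμ : ∀ i, 1 ≤ μ i) {d : ℕ} (hd : 2 ≤ d) {f₀ : MvPolynomial (Fin 2) ℂ}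
    (hf₀ : ∀ i, f₀ ∈ fatIdeal (P i) (μ i)) (hf₀d : (f₀ - X 0 ^ d).totalDegree ≤ d - 1)
    (hsep : ∀ q, (∀ i, q ≠ P i) → ∃ u, (∀ i, u ∈ fatIdeal (P i) (μ i)) ∧
      u.totalDegree ≤ d - 2 ∧ eval q u ≠ 0)
    (hlead : ∀ i, ∀ φ ∈ fatIdeal (P i) (μ i), ∃ g, (∀ i, g ∈ fatIdeal (P i) (μ i)) ∧
      g.totalDegree ≤ d - 1 ∧ g - φ ∈ fatIdeal (P i) (μ i + 1))
    (hinf : ∃ g, (∀ i, g ∈ fatIdeal (P i) (μ i)) ∧ g.totalDegree ≤ d - 1 ∧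
      coeff (Finsupp.single 1 (d - 1)) g ≠ 0) :
    ∃ f, (∀ i, f ∈ fatIdeal (P i) (μ i)) ∧ (f - X 0 ^ d).totalDegree ≤ d - 1 ∧
      coeff (Finsupp.single 1 (d - 1)) f ≠ 0 ∧
      (∀ i, eval ![0, 1] (taylorForm (P i) (μ i) f) ≠ 0 ∧
        ∀ s, eval ![1, s] (taylorForm (P i) (μ i) f) = 0 →
          eval ![1, s] (pderiv 1 (taylorForm (P i) (μ i) f)) ≠ 0) ∧
      ∀ q, (∀ i, q ≠ P i) → eval q f = 0 → ∃ j, eval q (pderiv j f) ≠ 0 := by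
  classical
  let W : Submodule ℂ (MvPolynomial (Fin 2) ℂ) := restrictTotalDegree (Fin 2) ℂ (d - 1) ⊓
    (⨅ i, fatIdeal (P i) (μ i)).restrictScalars ℂ
  have hmemW : ∀ {g}, g ∈ W ↔ g.totalDegree ≤ d - 1 ∧ ∀ i, g ∈ fatIdeal (P i) (μ i) := by
    intro g
    rw [Submodule.mem_inf, mem_restrictTotalDegree, Submodule.restrictScalars_mem,
      Submodule.mem_iInf]
  have hWfg : W.FG := Module.Finite.iff_fg.1
    (Submodule.finiteDimensional_of_le (inf_le_left : W ≤ restrictTotalDegree (Fin 2) ℂ (d - 1)))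
  let co : Module.End ℂ (MvPolynomial (Fin 2) ℂ) :=
    (Algebra.linearMap ℂ _) ∘ₗ lcoeff ℂ (Finsupp.single 1 (d - 1))
  let pd : Fin 2 → Module.End ℂ (MvPolynomial (Fin 2) ℂ) := fun j => (pderiv j).toLinearMap
  let ld : ι → Module.End ℂ (MvPolynomial (Fin 2) ℂ) := fun i => taylorForm (P i) (μ i)
  obtain ⟨w, hw, hgen⟩ := exists_general_member W hWfg
    ({1, co} ∪ Set.range pd ∪ Set.range ld ∪ Set.range fun i => pd 1 ∘ₗ ld i)
    (((((Set.finite_singleton _).insert _).union (Set.finite_range _)).union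
      (Set.finite_range _)).union (Set.finite_range _)).countable f₀
  rw [hmemW] at hw
  have hlead' : ∀ i, ∀ φ : MvPolynomial (Fin 2) ℂ, φ.IsHomogeneous (μ i) →
      ∃ g ∈ W, ld i g = φ := by
    intro i φ hφ
    obtain ⟨g, hg, hgd, h⟩ := hlead i _ (shift_neg_mem_fatIdeal hφ)
    refine ⟨g, hmemW.2 ⟨hgd, hg⟩, ?_⟩
    have := taylorForm_eq_zero h (Nat.lt_succ_self _)
    rw [map_sub, taylorForm_shift_neg hφ, sub_eq_zero] at this
    exact this
  refine ⟨f₀ + w, fun i => Ideal.add_mem _ (hf₀ i) (hw.2 i), ?_, ?_, fun i => ⟨?_, ?_⟩, ?_⟩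
  · rw [add_sub_right_comm]
    exact (totalDegree_add _ _).trans (max_le hf₀d hw.1)
  · obtain ⟨g, hg, hgd, h⟩ := hinf
    obtain ⟨l, hl⟩ := hgen 0 ∅ 0 (fun _ => co) (by simp) (by simp) (by simp) (fun l => by
      refine ⟨C (coeff (Finsupp.single 1 (d - 1)) g)⁻¹ * g, hmemW.2 ⟨?_, fun i => ?_⟩, ?_⟩
      · exact (totalDegree_mul _ _).trans (by simpa using hgd)
      · exact Ideal.mul_mem_left _ _ (hg i)
      · intro l'
        rw [Subsingleton.elim (α := Fin 1) l' l]
        simp [co, lcoeff_apply, h, -Finsupp.single_tsub])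
    simpa [co, lcoeff_apply] using hl
  · obtain ⟨l, hl⟩ := hgen 0 ∅ ![0, 1] (fun _ => ld i) (by simp) (by simp [Fin.forall_fin_two])
      (by simp) (fun l => by
      obtain ⟨g, hg, h⟩ := hlead' i (X 1 ^ μ i) (isHomogeneous_X_pow _ _)
      refine ⟨g, hg, fun l' => ?_⟩
      rw [Subsingleton.elim (α := Fin 1) l' l]
      simp [h])
    exact hl
  · intro s h0
    have hμ' : μ i - 1 + 1 = μ i := Nat.sub_add_cancel (hμ i)
    obtain ⟨l, hl⟩ := hgen 1 {s} ![1, s] ![ld i, pd 1 ∘ₗ ld i] (by simp)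
      (by simp [Fin.forall_fin_two]) (by simp [Fin.forall_fin_two]) (fun l => by
      fin_cases l
      · obtain ⟨g, hg, h⟩ := hlead' i (X 0 ^ μ i) (isHomogeneous_X_pow _ _)
        refine ⟨g, hg, ?_⟩
        simp [Fin.forall_fin_two, h, pd, pderiv_X]
      · obtain ⟨g, hg, h⟩ := hlead' i (X 0 ^ (μ i - 1) * (X 1 - C s * X 0)) (by
          nth_rewrite 2 [← hμ']
          refine (isHomogeneous_X_pow _ _).mul ((isHomogeneous_X _ _).sub ?_)
          simpa using (isHomogeneous_C (Fin 2) s).mul (isHomogeneous_X ℂ (0 : Fin 2)))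
        refine ⟨g, hg, ?_⟩
        simp [Fin.forall_fin_two, h, pd, pderiv_X])
    fin_cases l
    · exact absurd h0 hl
    · exact hl
  · intro q hq h0
    obtain ⟨u, hu, hud, huq⟩ := hsep q hq
    have hvar : ∀ j : Fin 2, (X j - C (q j) : MvPolynomial (Fin 2) ℂ).totalDegree ≤ 1 := fun j =>
      (totalDegree_sub_C_le _ _).trans (by simp)
    have hprod : ∀ j : Fin 2, (u * (X j - C (q j))).totalDegree ≤ d - 1 := fun j =>
      (totalDegree_mul _ _).trans (by have := hvar j; omega)
    have hjet : ∀ j : Fin 2, C (eval q u)⁻¹ * (u * (X j - C (q j))) ∈ W := fun j =>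
      hmemW.2 ⟨(totalDegree_mul _ _).trans (by simpa using hprod j), fun i =>
        Ideal.mul_mem_left _ _ (Ideal.mul_mem_right _ _ (hu i))⟩
    have huW : C (eval q u)⁻¹ * u ∈ W :=
      hmemW.2 ⟨(totalDegree_mul _ _).trans (by simp only [totalDegree_C]; omega), fun i =>
        Ideal.mul_mem_left _ _ (hu i)⟩
    obtain ⟨l, hl⟩ := hgen 2 {q 0, q 1} q ![1, pd 0, pd 1] Finset.card_le_two
      (by simp [Fin.forall_fin_two]) (by simp [Fin.forall_fin_succ]) (fun l => by
      fin_cases l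
      · refine ⟨C (eval q u)⁻¹ * u - ((eval q u)⁻¹ * eval q (pderiv 0 u)) •
          (C (eval q u)⁻¹ * (u * (X 0 - C (q 0)))) - ((eval q u)⁻¹ * eval q (pderiv 1 u)) •
          (C (eval q u)⁻¹ * (u * (X 1 - C (q 1)))), W.sub_mem (W.sub_mem huW
            (W.smul_mem _ (hjet 0))) (W.smul_mem _ (hjet 1)), ?_⟩
        simp [Fin.forall_fin_succ, pd, pderiv_X, huq]
      · refine ⟨_, hjet 0, ?_⟩
        simp [Fin.forall_fin_succ, pd, pderiv_X, huq]
      · refine ⟨_, hjet 1, ?_⟩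
        simp [Fin.forall_fin_succ, pd, pderiv_X, huq])
    fin_cases l
    · exact absurd h0 hl
    · exact ⟨0, hl⟩
    · exact ⟨1, hl⟩

lemma eval_smul_of_isHomogeneous {σ : Type*} {f : MvPolynomial σ ℂ} {n : ℕ}
    (hf : f.IsHomogeneous n) (c : ℂ) (v : σ → ℂ) : eval (c • v) f = c ^ n * eval v f := by
  rw [eval_eq, eval_eq, Finset.mul_sum]
  refine Finset.sum_congr rfl fun s hs => ?_
  have h := hf.degree_eq_sum_deg_support hs
  simp only [Pi.smul_apply, smul_eq_mul, mul_pow, Finset.prod_mul_distrib]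
  rw [Finset.prod_pow_eq_pow_sum, ← h]
  ring

lemma isUnit_of_forall_eval_ne_zero {p : MvPolynomial (Fin 2) ℂ}
    (h : ∀ v, v ≠ 0 → eval v p ≠ 0) : IsUnit p := by
  have hrad : ∀ j : Fin 2, ∃ n, p ∣ X j ^ n := by
    intro j
    have : (X j : MvPolynomial (Fin 2) ℂ) ∈ (Ideal.span {p}).radical := by
      rw [← vanishingIdeal_zeroLocus_eq_radical (K := ℂ), mem_vanishingIdeal_iff]
      intro x hx
      rw [zeroLocus_span] at hx
      have hx0 : x = 0 := by
        by_contra hne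
        refine h x hne ?_
        simpa [aeval_eq_eval] using hx p rfl
      simp [hx0]
    obtain ⟨n, hn⟩ := this
    exact ⟨n, Ideal.mem_span_singleton.1 hn⟩
  obtain ⟨n₀, h₀⟩ := hrad 0
  obtain ⟨n₁, h₁⟩ := hrad 1
  obtain ⟨i, -, hi⟩ := (dvd_prime_pow X_prime n₀).1 h₀
  rcases Nat.eq_zero_or_pos i with rfl | hpos
  · rw [pow_zero] at hi
    exact associated_one_iff_isUnit.1 hi
  · exfalso
    have h2 : (X 0 : MvPolynomial (Fin 2) ℂ) ∣ X 1 ^ n₁ :=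
      ((dvd_pow_self _ hpos.ne').trans hi.symm.dvd).trans h₁
    obtain ⟨q, hq⟩ := h2
    have := congrArg (eval ![(0 : ℂ), 1]) hq
    simp at this

/-- A binary form without multiple zeros is squarefree. -/
theorem squarefree_binary_form {φ : MvPolynomial (Fin 2) ℂ} {m : ℕ} (hφ : φ.IsHomogeneous m)
    (h01 : eval ![0, 1] φ ≠ 0)
    (h1s : ∀ s, eval ![1, s] φ = 0 → eval ![1, s] (pderiv 1 φ) ≠ 0) : Squarefree φ := by
  rintro p ⟨q, hq⟩
  refine isUnit_of_forall_eval_ne_zero fun v hv h0 => ?_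
  have hφv : eval v φ = 0 := by rw [hq, map_mul, map_mul, h0]; ring
  have hdv : eval v (pderiv 1 φ) = 0 := by
    rw [hq]
    simp [h0]
  by_cases hv0 : v 0 = 0
  · have hv1 : v 1 ≠ 0 := fun h => hv (by ext j; fin_cases j <;> simp [hv0, h])
    have : v = v 1 • ![0, 1] := by ext j; fin_cases j <;> simp [hv0]
    rw [this, eval_smul_of_isHomogeneous hφ] at hφv
    exact mul_ne_zero (pow_ne_zero _ hv1) h01 hφv
  · have : v = v 0 • ![1, v 1 / v 0] := by
      ext j; fin_cases j
      · simp
      · simp [mul_div_cancel₀ _ hv0]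
    rw [this, eval_smul_of_isHomogeneous hφ] at hφv
    rw [this, eval_smul_of_isHomogeneous hφ.pderiv] at hdv
    exact h1s _ ((mul_eq_zero.1 hφv).resolve_left (pow_ne_zero _ hv0))
      ((mul_eq_zero.1 hdv).resolve_left (pow_ne_zero _ hv0))

/-- The homogenization in degree `n` of a polynomial of degree at most `n`. -/
def homogenize (n : ℕ) (f : MvPolynomial (Fin 2) ℂ) : MvPolynomial (Fin 3) ℂ :=
  ∑ s ∈ f.support, C (coeff s f) * (X 0 ^ s 0 * X 1 ^ s 1 * X 2 ^ (n - s.degree))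

lemma degree_fin_two (s : Fin 2 →₀ ℕ) : s.degree = s 0 + s 1 := by
  simp [Finsupp.degree_eq_sum]

lemma degree_le_of_mem_support {n : ℕ} {f : MvPolynomial (Fin 2) ℂ} (hf : f.totalDegree ≤ n)
    {s : Fin 2 →₀ ℕ} (hs : s ∈ f.support) : s.degree ≤ n :=
  (le_totalDegree hs).trans hf

lemma isHomogeneous_homogenize {n : ℕ} {f : MvPolynomial (Fin 2) ℂ} (hf : f.totalDegree ≤ n) :
    (homogenize n f).IsHomogeneous n := by
  refine IsHomogeneous.sum _ _ _ fun s hs => ?_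
  have h := degree_le_of_mem_support hf hs
  have hd := degree_fin_two s
  have := (isHomogeneous_C (Fin 3) (coeff s f)).mul
    (((isHomogeneous_X_pow (R := ℂ) (0 : Fin 3) (s 0)).mul
      (isHomogeneous_X_pow (R := ℂ) (1 : Fin 3) (s 1))).mul
      (isHomogeneous_X_pow (R := ℂ) (2 : Fin 3) (n - s.degree)))
  convert! this using 1
  omega

lemma aeval_homogenize (n : ℕ) (f : MvPolynomial (Fin 2) ℂ) :
    aeval ![X 0, X 1, (1 : MvPolynomial (Fin 2) ℂ)] (homogenize n f) = f := by
  conv_rhs => rw [f.as_sum]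
  rw [homogenize, map_sum]
  refine Finset.sum_congr rfl fun s _ => ?_
  rw [monomial_eq, Finsupp.prod_fintype _ _ (by simp)]
  simp [Fin.prod_univ_two, algebraMap_eq]

lemma eval_homogenize_at_infinity {n : ℕ} {f : MvPolynomial (Fin 2) ℂ} (hf : f.totalDegree ≤ n)
    (y : ℂ) : eval ![0, y, 0] (homogenize n f) = coeff (Finsupp.single 1 n) f * y ^ n := by
  rw [homogenize, map_sum, Finset.sum_eq_single (Finsupp.single 1 n)]
  · simp
  · intro s hs hne
    have h := degree_le_of_mem_support hf hs
    have hd := degree_fin_two s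
    have : s 0 ≠ 0 ∨ n - s.degree ≠ 0 := by
      by_contra! h0
      refine hne ?_
      ext j
      fin_cases j
      · simp [h0.1]
      · simp; omega
    rcases this with h | h <;> simp [h]
  · intro h
    simp [notMem_support_iff.1 h]

/-- The projective closure in degree `d` of the affine curve `f = 0`, where `f - X₀ ^ d` has
degree less than `d`. -/
def projectiveClosure (d : ℕ) (f : MvPolynomial (Fin 2) ℂ) : MvPolynomial (Fin 3) ℂ :=
  X 0 ^ d + X 2 * homogenize (d - 1) (f - X 0 ^ d)

section ProjectiveClosure

variable {d : ℕ} {f : MvPolynomial (Fin 2) ℂ}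

lemma isHomogeneous_projectiveClosure (hd : 1 ≤ d) (hf : (f - X 0 ^ d).totalDegree ≤ d - 1) :
    (projectiveClosure d f).IsHomogeneous d := by
  refine (isHomogeneous_X_pow _ _).add ?_
  have := (isHomogeneous_X ℂ (2 : Fin 3)).mul (isHomogeneous_homogenize hf)
  rwa [Nat.add_sub_cancel' hd] at this

lemma aeval_projectiveClosure (d : ℕ) (f : MvPolynomial (Fin 2) ℂ) :
    aeval ![X 0, X 1, (1 : MvPolynomial (Fin 2) ℂ)] (projectiveClosure d f) = f := by
  rw [projectiveClosure, map_add, map_mul, aeval_homogenize]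
  simp

lemma eval_projectiveClosure (d : ℕ) (f : MvPolynomial (Fin 2) ℂ) (q : Fin 2 → ℂ) :
    eval ![q 0, q 1, 1] (projectiveClosure d f) = eval q f := by
  conv_rhs => rw [← aeval_projectiveClosure d f]
  have : (aeval q).comp (aeval ![X 0, X 1, (1 : MvPolynomial (Fin 2) ℂ)]) =
      (aeval ![q 0, q 1, 1] : MvPolynomial (Fin 3) ℂ →ₐ[ℂ] ℂ) := by
    ext j : 1
    fin_cases j <;> simp
  exact (DFunLike.congr_fun this _).symm

lemma pderiv_aeval_affine (j : Fin 2) (F : MvPolynomial (Fin 3) ℂ) :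
    pderiv j (aeval ![X 0, X 1, (1 : MvPolynomial (Fin 2) ℂ)] F) =
      aeval ![X 0, X 1, (1 : MvPolynomial (Fin 2) ℂ)] (pderiv j.castSucc F) := by
  induction F using MvPolynomial.induction_on with
  | C a => simp [algebraMap_eq]
  | add f g hf hg => simp only [map_add, hf, hg]
  | mul_X f i hf =>
    rw [map_mul, Derivation.leibniz, hf, Derivation.leibniz, map_add, smul_eq_mul, smul_eq_mul,
      smul_eq_mul, smul_eq_mul, map_mul, map_mul]
    congr 2
    fin_cases i <;> fin_cases j <;> simp [pderiv_X]

lemma eval_pderiv_projectiveClosure (d : ℕ) (f : MvPolynomial (Fin 2) ℂ) (q : Fin 2 → ℂ)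
    (j : Fin 2) : eval ![q 0, q 1, 1] (pderiv j.castSucc (projectiveClosure d f)) =
      eval q (pderiv j f) := by
  conv_rhs => rw [← aeval_projectiveClosure d f, pderiv_aeval_affine]
  have : (aeval q).comp (aeval ![X 0, X 1, (1 : MvPolynomial (Fin 2) ℂ)]) =
      (aeval ![q 0, q 1, 1] : MvPolynomial (Fin 3) ℂ →ₐ[ℂ] ℂ) := by
    ext j : 1
    fin_cases j <;> simp
  exact (DFunLike.congr_fun this _).symm

lemma eval_projectiveClosure_of_infinity {v : Fin 3 → ℂ} (hv : v 2 = 0) :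
    eval v (projectiveClosure d f) = v 0 ^ d := by
  simp [projectiveClosure, hv]

lemma eval_pderiv_projectiveClosure_at_infinity (hd : 1 ≤ d)
    (hf : (f - X 0 ^ d).totalDegree ≤ d - 1) (y : ℂ) :
    eval ![0, y, 0] (pderiv 2 (projectiveClosure d f)) =
      coeff (Finsupp.single 1 (d - 1)) f * y ^ (d - 1) := by
  have hX : coeff (Finsupp.single 1 (d - 1)) (X 0 ^ d : MvPolynomial (Fin 2) ℂ) = 0 := by
    rw [coeff_X_pow, if_neg]
    intro h
    have := DFunLike.congr_fun h 0
    simp at this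
    omega
  have := eval_homogenize_at_infinity hf y
  rw [coeff_sub, hX, sub_zero] at this
  rw [← this]
  simp [projectiveClosure, pderiv_X]

lemma pderiv_mul_eval_eq_zero {σ : Type*} {A B : MvPolynomial σ ℂ} {v : σ → ℂ}
    (hA : eval v A = 0) (hB : eval v B = 0) (j : σ) : eval v (pderiv j (A * B)) = 0 := by
  simp [hA, hB]

theorem irreducible_projectiveClosure (hd : 1 ≤ d) (hf : (f - X 0 ^ d).totalDegree ≤ d - 1)
    (hc : coeff (Finsupp.single 1 (d - 1)) f ≠ 0) : Irreducible (projectiveClosure d f) := by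
  let ρ : MvPolynomial (Fin 3) ℂ →ₐ[ℂ] MvPolynomial (Fin 2) ℂ := aeval ![X 0, X 1, 0]
  have hρ : ρ (projectiveClosure d f) = X 0 ^ d := by simp [ρ, projectiveClosure]
  have hprime : Prime (X 0 : MvPolynomial (Fin 2) ℂ) := X_prime
  have hdeg : ∀ A, (ρ A).totalDegree ≤ A.totalDegree :=
    totalDegree_aeval_le _ (fun j => by fin_cases j <;> simp)
  have hF0 : projectiveClosure d f ≠ 0 := by
    intro h
    rw [h, map_zero] at hρ
    exact pow_ne_zero _ (X_ne_zero _) hρ.symm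
  have hunit : ∀ A B, projectiveClosure d f = A * B → ¬ X 0 ∣ ρ A → IsUnit A := by
    intro A B hAB hA
    have hne := hF0
    rw [hAB] at hne
    have hA0 := left_ne_zero_of_mul hne
    have hB0 := right_ne_zero_of_mul hne
    have hAB' : ρ A * ρ B = X 0 ^ d := by rw [← map_mul, ← hAB, hρ]
    obtain ⟨i, -, hi⟩ := (dvd_prime_pow hprime d).1 ⟨_, hAB'.symm⟩
    have hi0 : i = 0 := by
      by_contra h
      exact hA ((dvd_pow_self _ h).trans hi.symm.dvd)
    rw [hi0, pow_zero, associated_one_iff_isUnit, isUnit_iff_totalDegree_of_isReduced] at hi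
    have h1 : (ρ A * ρ B).totalDegree = d := by rw [hAB', totalDegree_X_pow]
    have h2 := totalDegree_mul (ρ A) (ρ B)
    have h3 := hdeg B
    have h4 := totalDegree_mul_of_isDomain hA0 hB0
    rw [← hAB, (isHomogeneous_projectiveClosure hd hf).totalDegree hF0] at h4
    have h5 : A.totalDegree = 0 := by omega
    rw [isUnit_iff_totalDegree_of_isReduced]
    refine ⟨isUnit_iff_ne_zero.2 fun h => hA0 ?_, h5⟩
    rw [totalDegree_eq_zero_iff_eq_C.1 h5, h, map_zero]
  have hvan : ∀ A, X 0 ∣ ρ A → eval ![0, 1, 0] A = 0 := by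
    rintro A ⟨B, hB⟩
    have : (aeval ![0, 1]).comp ρ = (aeval ![0, 1, 0] : MvPolynomial (Fin 3) ℂ →ₐ[ℂ] ℂ) := by
      ext j : 1
      fin_cases j <;> simp [ρ]
    have h := DFunLike.congr_fun this A
    rw [AlgHom.comp_apply, hB] at h
    simpa [aeval_eq_eval] using h.symm
  refine ⟨fun h => ?_, fun A B hAB => ?_⟩
  · have := h.map ρ
    rw [hρ, isUnit_pow_iff (by omega)] at this
    exact hprime.not_isUnit this
  · by_contra! h
    have hA : X 0 ∣ ρ A := by
      by_contra hA
      exact h.1 (hunit A B hAB hA)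
    have hB : X 0 ∣ ρ B := by
      by_contra hB
      exact h.2 (hunit B A (by rw [hAB, mul_comm]) hB)
    have h1 := pderiv_mul_eval_eq_zero (hvan A hA) (hvan B hB) 2
    rw [← hAB, eval_pderiv_projectiveClosure_at_infinity hd hf] at h1
    rw [one_pow, mul_one] at h1
    exact hc h1

end ProjectiveClosure

/-- The point of the projective plane with affine coordinates `p`. -/
def affinePoint (p : Fin 2 → ℂ) : Proj2 :=
  Projectivization.mk ℂ ![p 0, p 1, 1] fun h => by simpa using congrFun h 2

lemma affinePoint_injective : Function.Injective affinePoint := by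
  intro p q h
  rw [affinePoint, affinePoint, Projectivization.mk_eq_mk_iff'] at h
  obtain ⟨a, ha⟩ := h
  have h2 : a = 1 := by simpa using congrFun ha 2
  subst h2
  ext j
  fin_cases j
  · simpa using (congrFun ha 0).symm
  · simpa using (congrFun ha 1).symm

lemma rep_eq_smul (Q : Proj2) (h : Q.rep 2 ≠ 0) :
    Q.rep = Q.rep 2 • ![Q.rep 0 / Q.rep 2, Q.rep 1 / Q.rep 2, 1] := by
  ext j
  fin_cases j <;> simp [mul_div_cancel₀ _ h]

lemma eq_affinePoint (Q : Proj2) (h : Q.rep 2 ≠ 0) :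
    Q = affinePoint ![Q.rep 0 / Q.rep 2, Q.rep 1 / Q.rep 2] := by
  conv_lhs => rw [← Q.mk_rep]
  rw [affinePoint, Projectivization.mk_eq_mk_iff']
  exact ⟨Q.rep 2, by simpa using (rep_eq_smul Q h).symm⟩

lemma chartPoly_translation (p : Fin 2 → ℂ) (F : MvPolynomial (Fin 3) ℂ) :
    chartPoly !![1, 0, p 0; 0, 1, p 1; 0, 0, 1] F =
      shift p (aeval ![X 0, X 1, (1 : MvPolynomial (Fin 2) ℂ)] F) := by
  have : (shift p).comp (aeval ![X 0, X 1, (1 : MvPolynomial (Fin 2) ℂ)]) =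
      (aeval (fun j : Fin 3 => ∑ i : Fin 3, C (!![1, 0, p 0; 0, 1, p 1; 0, 0, 1] j i) *
        ![X 0, X 1, (1 : MvPolynomial (Fin 2) ℂ)] i) :
        MvPolynomial (Fin 3) ℂ →ₐ[ℂ] MvPolynomial (Fin 2) ℂ) := by
    ext j : 1
    fin_cases j <;> simp [shift_X, Fin.sum_univ_three]
  exact (DFunLike.congr_fun this F).symm

lemma hasOrdinarySingularity_of_taylorForm {p : Fin 2 → ℂ} {m : ℕ} {F : MvPolynomial (Fin 3) ℂ}
    {f : MvPolynomial (Fin 2) ℂ}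
    (hF : aeval ![X 0, X 1, (1 : MvPolynomial (Fin 2) ℂ)] F = f) (hf : f ∈ fatIdeal p m)
    (h01 : eval ![0, 1] (taylorForm p m f) ≠ 0)
    (h1s : ∀ s, eval ![1, s] (taylorForm p m f) = 0 →
      eval ![1, s] (pderiv 1 (taylorForm p m f)) ≠ 0) :
    HasOrdinarySingularity m (affinePoint p) F := by
  have hv : (!![1, 0, p 0; 0, 1, p 1; 0, 0, 1] : Matrix (Fin 3) (Fin 3) ℂ).mulVec ![0, 0, 1] =
      ![p 0, p 1, 1] := by
    ext j
    fin_cases j <;> simp [Matrix.mulVec, dotProduct, Fin.sum_univ_three]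
  refine ⟨!![1, 0, p 0; 0, 1, p 1; 0, 0, 1], ?_, ?_, ?_, ?_⟩
  · simp [Matrix.det_fin_three]
  · rw [hv]
    exact fun h => by simpa using congrFun h 2
  · simp only [hv]
    rfl
  · rw [chartPoly_translation, hF]
    refine ⟨fun k hk => taylorForm_eq_zero hf hk, fun h => h01 ?_,
      squarefree_binary_form (homogeneousComponent_isHomogeneous _ _) h01 h1s⟩
    rw [taylorForm_apply, h, map_zero]

theorem smoothAwayFrom_projectiveClosure {d r : ℕ} {f : MvPolynomial (Fin 2) ℂ} (hd : 1 ≤ d)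
    (hf : (f - X 0 ^ d).totalDegree ≤ d - 1) (hc : coeff (Finsupp.single 1 (d - 1)) f ≠ 0)
    (P : Fin r → Fin 2 → ℂ)
    (hP : ∀ q, (∀ i, q ≠ P i) → eval q f = 0 → ∃ j, eval q (pderiv j f) ≠ 0) :
    SmoothAwayFrom (projectiveClosure d f) fun i => affinePoint (P i) := by
  intro Q hQ hQP
  have hhom := isHomogeneous_projectiveClosure hd hf
  by_cases h2 : Q.rep 2 = 0
  · rw [eval_projectiveClosure_of_infinity h2] at hQ
    have h0 : Q.rep 0 = 0 := pow_eq_zero_iff (by omega) |>.1 hQ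
    have hrep : Q.rep = ![0, Q.rep 1, 0] := by
      ext j
      fin_cases j <;> simp [h0, h2]
    have h1 : Q.rep 1 ≠ 0 := by
      intro h1
      refine Q.rep_nonzero ?_
      rw [hrep, h1]
      ext j
      fin_cases j <;> rfl
    refine ⟨2, ?_⟩
    rw [hrep, eval_pderiv_projectiveClosure_at_infinity hd hf]
    exact mul_ne_zero hc (pow_ne_zero _ h1)
  · have hrep := rep_eq_smul Q h2
    set q : Fin 2 → ℂ := ![Q.rep 0 / Q.rep 2, Q.rep 1 / Q.rep 2] with hq
    have hQq := eq_affinePoint Q h2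
    have hrep' : Q.rep = Q.rep 2 • ![q 0, q 1, 1] := hrep
    rw [hrep', eval_smul_of_isHomogeneous hhom, eval_projectiveClosure, mul_eq_zero] at hQ
    obtain ⟨j, hj⟩ := hP q (fun i h => hQP i (hQq.trans (congrArg affinePoint h)))
      (hQ.resolve_left (pow_ne_zero _ h2))
    refine ⟨j.castSucc, ?_⟩
    rw [hrep', eval_smul_of_isHomogeneous hhom.pderiv, eval_pderiv_projectiveClosure]
    exact mul_ne_zero (pow_ne_zero _ h2) hj

lemma exists_line {q : Fin 2 → ℂ} (T : Finset (Fin 2 → ℂ)) (hq : q ∉ T) :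
    ∃ l : MvPolynomial (Fin 2) ℂ, l.totalDegree ≤ 1 ∧ eval q l = 0 ∧ ∀ p ∈ T, eval p l ≠ 0 := by
  classical
  obtain ⟨a, ha⟩ := Infinite.exists_notMem_finset (T.image fun p => -(p 0 - q 0) / (p 1 - q 1))
  refine ⟨X 0 - C (q 0) + C a * (X 1 - C (q 1)), ?_, by simp, fun p hp h => ?_⟩
  · refine (totalDegree_add _ _).trans (max_le ?_ ((totalDegree_mul _ _).trans ?_))
    · exact (totalDegree_sub_C_le _ _).trans (by simp)
    · rw [totalDegree_C, zero_add]
      exact (totalDegree_sub_C_le _ _).trans (by simp)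
  · simp only [map_add, map_sub, eval_X, eval_C, map_mul] at h
    by_cases h1 : p 1 - q 1 = 0
    · refine hq ?_
      have : q = p := by
        ext j
        fin_cases j
        · simp only [h1, mul_zero, add_zero] at h
          exact (sub_eq_zero.1 h).symm
        · exact (sub_eq_zero.1 h1).symm
      rwa [this]
    · refine ha (Finset.mem_image.2 ⟨p, hp, ?_⟩)
      rw [div_eq_iff h1]
      linear_combination -h

lemma Interpolates.exists_correction {ι : Type*} {I : Ideal (MvPolynomial (Fin 2) ℂ)} {e : ℕ}
    {S : Finset ι} {P : ι → Fin 2 → ℂ} {μ : ι → ℕ} (h : Interpolates I e S P μ)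
    (v : MvPolynomial (Fin 2) ℂ) {l : MvPolynomial (Fin 2) ℂ} (hl : ∀ i ∈ S, eval (P i) l ≠ 0) :
    ∃ w ∈ I, w.totalDegree ≤ e ∧ ∀ i ∈ S, v - l * w ∈ fatIdeal (P i) (μ i) := by
  have hinv : ∀ i, ∃ l', i ∈ S → l * l' - 1 ∈ fatIdeal (P i) (μ i) := by
    intro i
    by_cases hi : i ∈ S
    · obtain ⟨l', hl'⟩ := exists_inverse_mod_fatIdeal (hl i hi) (μ i)
      exact ⟨l', fun _ => hl'⟩
    · exact ⟨0, fun h => absurd h hi⟩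
  choose l' hl' using hinv
  obtain ⟨w, hw, hwd, hwt⟩ := h fun i => l' i * v
  refine ⟨w, hw, hwd, fun i hi => ?_⟩
  have : v - l * w = -(v * (l * l' i - 1)) - l * (w - l' i * v) := by ring
  rw [this]
  exact Ideal.sub_mem _ (neg_mem (Ideal.mul_mem_left _ _ (hl' i hi)))
    (Ideal.mul_mem_left _ _ (hwt i hi))

lemma Interpolates.exists_taylorForm {ι : Type*} {I : Ideal (MvPolynomial (Fin 2) ℂ)} {e : ℕ}
    {S : Finset ι} {P : ι → Fin 2 → ℂ} {μ : ι → ℕ} (h : Interpolates I e S P μ) {i : ι}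
    (hi : i ∈ S) (hμ : 1 ≤ μ i) {φ : MvPolynomial (Fin 2) ℂ} (hφ : φ ∈ fatIdeal (P i) (μ i)) :
    ∃ g ∈ I, (∀ j ∈ S, g ∈ fatIdeal (P j) (μ j)) ∧ g.totalDegree ≤ e + 1 ∧
      g - φ ∈ fatIdeal (P i) (μ i + 1) := by
  classical
  obtain ⟨k, hk⟩ : ∃ k, μ i = k + 1 := ⟨μ i - 1, by omega⟩
  have hφ' := hk ▸ hφ
  refine fatIdeal_succ_induction hφ' (motive := fun φ => ∃ g ∈ I, (∀ j ∈ S, g ∈ fatIdeal (P j) (μ j))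
    ∧ g.totalDegree ≤ e + 1 ∧ g - φ ∈ fatIdeal (P i) (μ i + 1)) ?_ ?_
  · intro a ha b hb
    obtain ⟨w, hwI, hwd, hw⟩ := h (Function.update 0 i a)
    obtain ⟨b', hbd, hb'⟩ := exists_truncation (P i) 1 b
    have hwi : w - a ∈ fatIdeal (P i) (μ i) := by simpa using hw i hi
    have hb1 : b' ∈ fatIdeal (P i) 1 := by
      have := Ideal.add_mem _ (fatIdeal_anti (P i) one_le_two hb') hb
      rwa [sub_add_cancel] at this
    have hg : b' * w - a * b ∈ fatIdeal (P i) (μ i + 1) := by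
      have : b' * w - a * b = b' * (w - a) + (b' - b) * a := by ring
      rw [this]
      exact Ideal.add_mem _ (mul_mem_fatIdeal hb1 hwi (by omega))
        (mul_mem_fatIdeal hb' ha (by omega))
    refine ⟨b' * w, I.mul_mem_left _ hwI, fun j hj => ?_, ?_, hg⟩
    · rcases eq_or_ne j i with rfl | hne
      · have := Ideal.add_mem _ (fatIdeal_anti _ (Nat.le_succ _) hg)
          (mul_mem_fatIdeal ha hb (by omega) : a * b ∈ fatIdeal (P j) (μ j))
        rwa [sub_add_cancel] at this
      · refine Ideal.mul_mem_left _ _ ?_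
        simpa [Function.update_of_ne hne] using hw j hj
    · exact (totalDegree_mul _ _).trans (by omega)
  · rintro a b ⟨g, hg, hgS, hgd, hga⟩ ⟨g', hg', hgS', hgd', hgb⟩
    refine ⟨g + g', I.add_mem hg hg', fun j hj => Ideal.add_mem _ (hgS j hj) (hgS' j hj),
      (totalDegree_add _ _).trans (max_le hgd hgd'), ?_⟩
    rw [add_sub_add_comm]
    exact Ideal.add_mem _ hga hgb

/-- Existence of curves with ordinary singularities at the union of a special set of points,
for which there is a sufficiently large ideal `I` with the required multiplicities, and a set
`S` of points at which `I` interpolates. -/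
theorem exists_curve_of_interpolates {r d : ℕ} (hd : 3 ≤ d) {I : Ideal (MvPolynomial (Fin 2) ℂ)}
    {S : Finset (Fin r)} {P : Fin r → Fin 2 → ℂ} (hP : Function.Injective P) {μ : Fin r → ℕ}
    (hμ : ∀ i, 1 ≤ μ i) (hS : Interpolates I (d - 3) S P μ)
    (hI : ∀ i ∉ S, I ≤ fatIdeal (P i) (μ i))
    (hsep : ∀ q, (∀ i ∉ S, q ≠ P i) → ∃ v ∈ I, v.totalDegree ≤ d - 2 ∧ eval q v ≠ 0)
    (hlead : ∀ i ∉ S, ∀ φ ∈ fatIdeal (P i) (μ i), ∃ v ∈ I, v.totalDegree ≤ d - 1 ∧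
      v - φ ∈ fatIdeal (P i) (μ i + 1))
    (htop : ∃ v ∈ I, (v - X 0 ^ d).totalDegree ≤ d - 1)
    (hinf : ∃ v ∈ I, v.totalDegree ≤ d - 1 ∧ coeff (Finsupp.single 1 (d - 1)) v ≠ 0) :
    ∃ (P : Fin r → Proj2) (F : MvPolynomial (Fin 3) ℂ),
      Function.Injective P ∧ F ∈ homogeneousSubmodule (Fin 3) ℂ d ∧ Irreducible F ∧
      (∀ i, HasOrdinarySingularity (μ i) (P i) F) ∧ SmoothAwayFrom F P := by
  classical
  have hall : ∀ {g}, g ∈ I → (∀ i ∈ S, g ∈ fatIdeal (P i) (μ i)) →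
      ∀ i, g ∈ fatIdeal (P i) (μ i) := fun hg h i =>
    if hi : i ∈ S then h i hi else hI i hi hg
  have hsub : ∀ {u v : MvPolynomial (Fin 2) ℂ} {n : ℕ}, u.totalDegree ≤ n → v.totalDegree ≤ n →
      (u - v).totalDegree ≤ n := fun hu hv => (totalDegree_sub _ _).trans (max_le hu hv)
  have hmul : ∀ {l w : MvPolynomial (Fin 2) ℂ}, l.totalDegree ≤ 1 → w.totalDegree ≤ d - 3 →
      (l * w).totalDegree ≤ d - 2 := fun hl hw => (totalDegree_mul _ _).trans (by omega)
  have hline : ∀ q, (∀ i ∈ S, q ≠ P i) → ∃ l : MvPolynomial (Fin 2) ℂ, l.totalDegree ≤ 1 ∧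
      eval q l = 0 ∧ ∀ i ∈ S, eval (P i) l ≠ 0 := by
    intro q hq
    obtain ⟨l, h1, h2, h3⟩ := exists_line (q := q) (S.image P) (by
      simp only [Finset.mem_image, not_exists, not_and]
      exact fun i hi h => hq i hi h.symm)
    exact ⟨l, h1, h2, fun i hi => h3 _ (Finset.mem_image_of_mem _ hi)⟩
  obtain ⟨v₀, hv₀, hv₀d⟩ := htop
  obtain ⟨w₀, hw₀, hw₀d, hw₀S⟩ := hS.exists_correction v₀ (l := 1) (by simp)
  rw [one_mul] at hw₀S
  obtain ⟨f, hf, hfd, hfc, hford, hfsm⟩ := exists_curve_of_jets P μ hμ (d := d) (by omega)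
    (f₀ := v₀ - w₀) (hall (I.sub_mem hv₀ hw₀) hw₀S)
    (by rw [sub_right_comm]; exact hsub hv₀d (by omega))
    (by
      intro q hq
      obtain ⟨v, hv, hvd, hvq⟩ := hsep q fun i _ => hq i
      obtain ⟨l, hl, hlq, hlS⟩ := hline q fun i _ => hq i
      obtain ⟨w, hw, hwd, hwS⟩ := hS.exists_correction v hlS
      refine ⟨v - l * w, hall (I.sub_mem hv (I.mul_mem_left _ hw)) hwS,
        hsub hvd (hmul hl hwd), ?_⟩
      simpa [hlq] using hvq)
    (by
      intro i φ hφ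
      by_cases hi : i ∈ S
      · obtain ⟨g, hg, hgS, hgd, h⟩ := hS.exists_taylorForm hi (hμ i) hφ
        exact ⟨g, hall hg hgS, by omega, h⟩
      · obtain ⟨v, hv, hvd, hvφ⟩ := hlead i hi φ hφ
        obtain ⟨l, hl, hlq, hlS⟩ := hline (P i) fun j hj h => hi (hP h ▸ hj)
        obtain ⟨w, hw, hwd, hwS⟩ := hS.exists_correction v hlS
        refine ⟨v - l * w, hall (I.sub_mem hv (I.mul_mem_left _ hw)) hwS,
          hsub hvd ((hmul hl hwd).trans (by omega)), ?_⟩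
        rw [sub_right_comm]
        exact Ideal.sub_mem _ hvφ (mul_mem_fatIdeal (mem_fatIdeal_one.2 hlq) (hI i hi hw)
          (by omega)))
    (by
      obtain ⟨v, hv, hvd, hvc⟩ := hinf
      obtain ⟨w, hw, hwd, hwS⟩ := hS.exists_correction v (l := 1) (by simp)
      rw [one_mul] at hwS
      refine ⟨v - w, hall (I.sub_mem hv hw) hwS, hsub hvd (by omega), ?_⟩
      rw [coeff_sub, coeff_eq_zero_of_totalDegree_lt (f := w), sub_zero]
      · exact hvc
      · rw [← Finsupp.degree_apply, Finsupp.degree_single]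
        omega)
  have hd1 : 1 ≤ d := by omega
  exact ⟨fun i => affinePoint (P i), projectiveClosure d f, affinePoint_injective.comp hP,
    isHomogeneous_projectiveClosure hd1 hfd, irreducible_projectiveClosure hd1 hfd hfc,
    fun i => hasOrdinarySingularity_of_taylorForm (aeval_projectiveClosure d f) (hf i)
      (hford i).1 (hford i).2, smoothAwayFrom_projectiveClosure hd1 hfd hfc P hfsm⟩

/-- The product polynomial `p(X₀) q(X₁)`. -/
def prodPoly (p q : Polynomial ℂ) : MvPolynomial (Fin 2) ℂ :=
  Polynomial.aeval (X 0) p * Polynomial.aeval (X 1) q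

lemma coeff_prodPoly (p q : Polynomial ℂ) (s : Fin 2 →₀ ℕ) :
    coeff s (prodPoly p q) = p.coeff (s 0) * q.coeff (s 1) := by
  unfold prodPoly
  induction p using Polynomial.induction_on' with
  | add p₁ p₂ h₁ h₂ => rw [map_add, add_mul, coeff_add, h₁, h₂, Polynomial.coeff_add, add_mul]
  | monomial n a =>
    induction q using Polynomial.induction_on' with
    | add q₁ q₂ h₁ h₂ => rw [map_add, mul_add, coeff_add, h₁, h₂, Polynomial.coeff_add, mul_add]
    | monomial l b =>
      have : Polynomial.aeval (X 0 : MvPolynomial (Fin 2) ℂ) (Polynomial.monomial n a) *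
          Polynomial.aeval (X 1 : MvPolynomial (Fin 2) ℂ) (Polynomial.monomial l b) =
          monomial (Finsupp.single 0 n + Finsupp.single 1 l) (a * b) := by
        rw [Polynomial.aeval_monomial, Polynomial.aeval_monomial, X_pow_eq_monomial,
          X_pow_eq_monomial, algebraMap_eq, C_mul_monomial, C_mul_monomial, monomial_mul]
        simp
      rw [this, coeff_monomial, Polynomial.coeff_monomial, Polynomial.coeff_monomial]
      have : (Finsupp.single 0 n + Finsupp.single 1 l = s) ↔ n = s 0 ∧ l = s 1 := by
        rw [Finsupp.ext_iff, Fin.forall_fin_two]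
        simp
      simp only [this]
      split_ifs <;> simp_all

lemma eval_prodPoly (p q : Polynomial ℂ) (v : Fin 2 → ℂ) :
    eval v (prodPoly p q) = p.eval (v 0) * q.eval (v 1) := by
  have h : ∀ (f : Polynomial ℂ) (j : Fin 2),
      eval v (Polynomial.aeval (X j : MvPolynomial (Fin 2) ℂ) f) = f.eval (v j) := by
    intro f j
    have hid : (eval v).comp (algebraMap ℂ (MvPolynomial (Fin 2) ℂ)) = RingHom.id ℂ :=
      RingHom.ext fun a => by simp
    rw [Polynomial.aeval_def, Polynomial.hom_eval₂, hid, eval_X, Polynomial.eval₂_id]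
  rw [prodPoly, map_mul, h, h]

lemma totalDegree_prodPoly_le (p q : Polynomial ℂ) :
    (prodPoly p q).totalDegree ≤ p.natDegree + q.natDegree := by
  refine Finset.sup_le fun s hs => ?_
  rw [mem_support_iff, coeff_prodPoly, mul_ne_zero_iff] at hs
  change s.degree ≤ _
  rw [degree_fin_two]
  exact add_le_add (Polynomial.le_natDegree_of_ne_zero hs.1)
    (Polynomial.le_natDegree_of_ne_zero hs.2)

lemma linearIndependent_prodPoly (p q : ℕ → Polynomial ℂ) (hp : ∀ a, (p a).Monic)
    (hq : ∀ a, (q a).Monic) (hpd : ∀ a, (p a).natDegree = a) (hqd : ∀ a, (q a).natDegree = a) :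
    LinearIndependent ℂ fun t : ℕ × ℕ => prodPoly (p t.1) (q t.2) := by
  rw [linearIndependent_iff']
  intro s w hw
  by_contra! hne
  obtain ⟨i, hi, hwi⟩ := hne
  obtain ⟨t₀, ht₀, hmax⟩ := (s.filter fun t => w t ≠ 0).exists_max_image (fun t => t.1 + t.2)
    ⟨i, Finset.mem_filter.2 ⟨hi, hwi⟩⟩
  rw [Finset.mem_filter] at ht₀
  have h := congrArg (coeff (Finsupp.single 0 t₀.1 + Finsupp.single 1 t₀.2)) hw
  rw [coeff_sum, Finset.sum_eq_single_of_mem t₀ ht₀.1] at h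
  · have h1 : (p t₀.1).coeff t₀.1 = 1 := by simpa [hpd] using (hp t₀.1).coeff_natDegree
    have h2 : (q t₀.2).coeff t₀.2 = 1 := by simpa [hqd] using (hq t₀.2).coeff_natDegree
    rw [coeff_smul, coeff_prodPoly] at h
    simp [h1, h2] at h
    exact ht₀.2 h
  · intro t ht htne
    rw [coeff_smul, coeff_prodPoly]
    by_contra hc
    simp at hc
    have h1 := Polynomial.le_natDegree_of_ne_zero hc.2.1
    have h2 := Polynomial.le_natDegree_of_ne_zero hc.2.2
    rw [hpd] at h1
    rw [hqd] at h2
    have h3 := hmax t (Finset.mem_filter.2 ⟨ht, hc.1⟩)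
    exact htne (Prod.ext (by omega) (by omega))

lemma prodPoly_mul_prodPoly (p q p' q' : Polynomial ℂ) :
    prodPoly p q * prodPoly p' q' = prodPoly (p * p') (q * q') := by
  simp only [prodPoly, map_mul]
  ring

/-- The monic polynomial with simple roots `0, 1, …, h - 1`. -/
def rootsPoly (h : ℕ) : Polynomial ℂ :=
  ∏ i ∈ Finset.range h, (Polynomial.X - Polynomial.C (i : ℂ))

lemma monic_rootsPoly (h : ℕ) : (rootsPoly h).Monic :=
  Polynomial.monic_prod_of_monic _ _ fun _ _ => Polynomial.monic_X_sub_C _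

lemma natDegree_rootsPoly (h : ℕ) : (rootsPoly h).natDegree = h := by
  rw [rootsPoly, Polynomial.natDegree_prod_of_monic _ _ fun _ _ => Polynomial.monic_X_sub_C _]
  simp only [Polynomial.natDegree_X_sub_C, Finset.sum_const, Finset.card_range, smul_eq_mul,
    mul_one]

lemma eval_rootsPoly_eq_zero_iff {h : ℕ} {z : ℂ} :
    (rootsPoly h).eval z = 0 ↔ ∃ i < h, z = (i : ℂ) := by
  simp [rootsPoly, Polynomial.eval_prod, Finset.prod_eq_zero_iff, sub_eq_zero]

/-- `rootsPoly h` is the product of `X - i` and a factor not vanishing at `i`. -/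
lemma exists_rootsPoly_eq {h i : ℕ} (hi : i < h) :
    ∃ u : Polynomial ℂ, rootsPoly h = (Polynomial.X - Polynomial.C (i : ℂ)) * u ∧
      u.eval (i : ℂ) ≠ 0 := by
  refine ⟨∏ j ∈ (Finset.range h).erase i, (Polynomial.X - Polynomial.C (j : ℂ)), ?_, ?_⟩
  · rw [rootsPoly, Finset.mul_prod_erase _ (fun j : ℕ => Polynomial.X - Polynomial.C (j : ℂ))
      (Finset.mem_range.2 hi)]
  · rw [Polynomial.eval_prod, Finset.prod_ne_zero_iff]
    intro j hj
    have := (Finset.mem_erase.1 hj).1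
    simp [sub_eq_zero, Ne.symm this]

/-- A monic polynomial of degree `a` divisible by a high power of `rootsPoly h`. -/
def gridBasis (h a : ℕ) : Polynomial ℂ := Polynomial.X ^ (a % h) * rootsPoly h ^ (a / h)

lemma monic_gridBasis (h a : ℕ) : (gridBasis h a).Monic :=
  (Polynomial.monic_X_pow _).mul ((monic_rootsPoly h).pow _)

lemma natDegree_gridBasis (h a : ℕ) : (gridBasis h a).natDegree = a := by
  rw [gridBasis, (Polynomial.monic_X_pow _).natDegree_mul ((monic_rootsPoly h).pow _),
    Polynomial.natDegree_X_pow, (monic_rootsPoly h).natDegree_pow, natDegree_rootsPoly,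
    mul_comm (a / h), Nat.mod_add_div]

/-- The `k`-th power of the ideal of the grid `{0, …, h - 1} × {0, …, g - 1}`. -/
def gridIdeal (h g k : ℕ) : Ideal (MvPolynomial (Fin 2) ℂ) :=
  Ideal.span {prodPoly (rootsPoly h) 1, prodPoly 1 (rootsPoly g)} ^ k

lemma prodPoly_pow (p q : Polynomial ℂ) (n : ℕ) : prodPoly p q ^ n = prodPoly (p ^ n) (q ^ n) := by
  simp only [prodPoly, mul_pow, map_pow]

lemma rootsPoly_mul_mem_gridIdeal {h g k i j : ℕ} (hk : k ≤ i + j) (p q : Polynomial ℂ) :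
    prodPoly (p * rootsPoly h ^ i) (q * rootsPoly g ^ j) ∈ gridIdeal h g k := by
  have h1 : prodPoly (p * rootsPoly h ^ i) (q * rootsPoly g ^ j) =
      prodPoly p q * (prodPoly (rootsPoly h) 1 ^ i * prodPoly 1 (rootsPoly g) ^ j) := by
    simp only [prodPoly_pow, prodPoly_mul_prodPoly, one_pow, one_mul, mul_one]
  rw [h1]
  refine Ideal.mul_mem_left _ _ (Ideal.pow_le_pow_right hk ?_)
  rw [pow_add]
  exact Ideal.mul_mem_mul (Ideal.pow_mem_pow (Ideal.subset_span (by simp)) _)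
    (Ideal.pow_mem_pow (Ideal.subset_span (by simp)) _)

/-- The point `(i, j)` of the affine plane. -/
def gridPoint (i j : ℕ) : Fin 2 → ℂ := ![(i : ℂ), (j : ℂ)]

lemma gridPoint_injective : Function.Injective fun t : ℕ × ℕ => gridPoint t.1 t.2 := by
  intro s t hst
  have h0 := congrFun hst 0
  have h1 := congrFun hst 1
  simp only [gridPoint, Matrix.cons_val_zero, Matrix.cons_val_one, Nat.cast_inj] at h0 h1
  exact Prod.ext h0 h1

lemma fatIdeal_pow_le (p : Fin 2 → ℂ) (m : ℕ) : fatIdeal p 1 ^ m ≤ fatIdeal p m := by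
  simp only [fatIdeal, pow_one]
  exact Ideal.le_comap_pow _ _

lemma gridIdeal_le_fatIdeal {h g k i j : ℕ} (hi : i < h) (hj : j < g) :
    gridIdeal h g k ≤ fatIdeal (gridPoint i j) k := by
  refine (Ideal.pow_right_mono ?_ k).trans (fatIdeal_pow_le _ _)
  rw [Ideal.span_le, Set.insert_subset_iff, Set.singleton_subset_iff]
  constructor
  · rw [SetLike.mem_coe, mem_fatIdeal_one, eval_prodPoly]
    exact mul_eq_zero_of_left (eval_rootsPoly_eq_zero_iff.2 ⟨i, hi, rfl⟩) _
  · rw [SetLike.mem_coe, mem_fatIdeal_one, eval_prodPoly]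
    exact mul_eq_zero_of_right _ (eval_rootsPoly_eq_zero_iff.2 ⟨j, hj, rfl⟩)

lemma exists_gridIdeal_eval_ne_zero {h g k n : ℕ} (hh : k * h ≤ n) (hg : k * g ≤ n)
    {q : Fin 2 → ℂ} (hq : ∀ i < h, ∀ j < g, q ≠ gridPoint i j) :
    ∃ v ∈ gridIdeal h g k, v.totalDegree ≤ n ∧ eval q v ≠ 0 := by
  by_cases h0 : (rootsPoly h).eval (q 0) = 0
  · by_cases h1 : (rootsPoly g).eval (q 1) = 0
    · obtain ⟨i, hi, hqi⟩ := eval_rootsPoly_eq_zero_iff.1 h0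
      obtain ⟨j, hj, hqj⟩ := eval_rootsPoly_eq_zero_iff.1 h1
      refine absurd ?_ (hq i hi j hj)
      funext l
      fin_cases l
      · exact hqi
      · exact hqj
    · refine ⟨_, rootsPoly_mul_mem_gridIdeal (i := 0) (j := k) (by omega) 1 1, ?_, ?_⟩
      · refine (totalDegree_prodPoly_le _ _).trans ?_
        simpa [(monic_rootsPoly g).natDegree_pow, natDegree_rootsPoly] using hg
      · simp [eval_prodPoly, h1]
  · refine ⟨_, rootsPoly_mul_mem_gridIdeal (i := k) (j := 0) (by omega) 1 1, ?_, ?_⟩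
    · refine (totalDegree_prodPoly_le _ _).trans ?_
      simpa [(monic_rootsPoly h).natDegree_pow, natDegree_rootsPoly] using hh
    · simp [eval_prodPoly, h0]

lemma exists_eq_of_mem_fatIdeal_one {p : Fin 2 → ℂ} {b : MvPolynomial (Fin 2) ℂ}
    (hb : b ∈ fatIdeal p 1) : ∃ b₀ b₁, b = b₀ * (X 0 - C (p 0)) + b₁ * (X 1 - C (p 1)) := by
  rw [mem_fatIdeal, pow_one, idealOfVars, Ideal.mem_span_range_iff_exists_fun] at hb
  obtain ⟨c, hc⟩ := hb
  refine ⟨shift (-p) (c 0), shift (-p) (c 1), ?_⟩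
  have h := congrArg (shift (-p)) hc
  rw [shift_neg_shift] at h
  rw [← h, Fin.sum_univ_two, map_add, map_mul, map_mul, shift_X, shift_X]
  simp [sub_eq_add_neg]

lemma exists_gridIdeal_one_lead {h g i j : ℕ} (hi : i < h) (hj : j < g) (hgh : g ≤ h)
    {b : MvPolynomial (Fin 2) ℂ} (hb : b ∈ fatIdeal (gridPoint i j) 1) :
    ∃ v ∈ gridIdeal h g 1, v.totalDegree ≤ h ∧ v - b ∈ fatIdeal (gridPoint i j) 2 := by
  obtain ⟨b₀, b₁, rfl⟩ := exists_eq_of_mem_fatIdeal_one hb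
  obtain ⟨u, hu, hu0⟩ := exists_rootsPoly_eq hi
  obtain ⟨w, hw, hw0⟩ := exists_rootsPoly_eq hj
  set p := gridPoint i j with hp
  have hp0 : p 0 = i := rfl
  have hp1 : p 1 = j := rfl
  have hH : prodPoly (rootsPoly h) 1 = (X 0 - C (p 0)) * prodPoly u 1 := by
    rw [hu, hp0]
    simp [prodPoly]
  have hG : prodPoly 1 (rootsPoly g) = (X 1 - C (p 1)) * prodPoly 1 w := by
    rw [hw, hp1]
    simp [prodPoly]
  have e0 : ∀ l : Fin 2, (X l - C (p l) : MvPolynomial (Fin 2) ℂ) ∈ fatIdeal p 1 := by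
    intro l
    simp [mem_fatIdeal_one]
  refine ⟨C (eval p b₀ / u.eval (i : ℂ)) * prodPoly (rootsPoly h) 1 +
    C (eval p b₁ / w.eval (j : ℂ)) * prodPoly 1 (rootsPoly g), ?_, ?_, ?_⟩
  · rw [gridIdeal, pow_one]
    exact add_mem (Ideal.mul_mem_left _ _ (Ideal.subset_span (by simp)))
      (Ideal.mul_mem_left _ _ (Ideal.subset_span (by simp)))
  · refine (totalDegree_add _ _).trans (max_le ?_ ?_)
    · refine (totalDegree_mul _ _).trans ?_
      rw [totalDegree_C, zero_add]
      refine (totalDegree_prodPoly_le _ _).trans ?_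
      simp [natDegree_rootsPoly]
    · refine (totalDegree_mul _ _).trans ?_
      rw [totalDegree_C, zero_add]
      refine (totalDegree_prodPoly_le _ _).trans ?_
      simpa [natDegree_rootsPoly] using hgh
  · have e1 : C (eval p b₀ / u.eval (i : ℂ)) * prodPoly u 1 - b₀ ∈ fatIdeal p 1 := by
      rw [mem_fatIdeal_one, map_sub, map_mul, eval_C, eval_prodPoly, hp0]
      simp [hu0]
    have e2 : C (eval p b₁ / w.eval (j : ℂ)) * prodPoly 1 w - b₁ ∈ fatIdeal p 1 := by
      rw [mem_fatIdeal_one, map_sub, map_mul, eval_C, eval_prodPoly, hp1]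
      simp [hw0]
    have := add_mem (mul_mem_fatIdeal (e0 0) e1 (k := 2) le_rfl)
      (mul_mem_fatIdeal (e0 1) e2 (k := 2) le_rfl)
    convert this using 1
    rw [hH, hG]
    ring

/-- Every leading form at a grid point is realized by an element of the grid ideal of small
degree. -/
lemma exists_gridIdeal_lead {h g i j : ℕ} (hi : i < h) (hj : j < g) (hgh : g ≤ h) (k : ℕ)
    {φ : MvPolynomial (Fin 2) ℂ} (hφ : φ ∈ fatIdeal (gridPoint i j) k) :
    ∃ v ∈ gridIdeal h g k, v.totalDegree ≤ k * h ∧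
      v - φ ∈ fatIdeal (gridPoint i j) (k + 1) := by
  induction k generalizing φ with
  | zero =>
    refine ⟨C (eval (gridPoint i j) φ), by simp [gridIdeal], by simp, ?_⟩
    simp [mem_fatIdeal_one]
  | succ k ih =>
    refine fatIdeal_succ_induction hφ (motive := fun φ => ∃ v ∈ gridIdeal h g (k + 1),
      v.totalDegree ≤ (k + 1) * h ∧ v - φ ∈ fatIdeal (gridPoint i j) (k + 1 + 1)) ?_ ?_
    · intro a ha b hb
      obtain ⟨v, hv, hvd, hva⟩ := ih ha
      obtain ⟨w, hw, hwd, hwb⟩ := exists_gridIdeal_one_lead hi hj hgh hb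
      refine ⟨v * w, ?_, ?_, ?_⟩
      · have := Ideal.mul_mem_mul hv hw
        rwa [gridIdeal, gridIdeal, ← pow_add] at this
      · rw [add_mul, one_mul]
        exact (totalDegree_mul _ _).trans (add_le_add hvd hwd)
      · have e : v * w - a * b = v * (w - b) + (v - a) * b := by ring
        rw [e]
        exact add_mem (mul_mem_fatIdeal (gridIdeal_le_fatIdeal hi hj hv) hwb (by omega))
          (mul_mem_fatIdeal hva hb (by omega))
    · rintro a b ⟨v, hv, hvd, hva⟩ ⟨w, hw, hwd, hwb⟩
      refine ⟨v + w, add_mem hv hw, (totalDegree_add _ _).trans (max_le hvd hwd), ?_⟩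
      have e : v + w - (a + b) = (v - a) + (w - b) := by ring
      rw [e]
      exact add_mem hva hwb

lemma exists_gridIdeal_top {h k d : ℕ} (g : ℕ) (hkh : k * h ≤ d) (hd : 1 ≤ d) :
    ∃ v ∈ gridIdeal h g k, (v - X 0 ^ d).totalDegree ≤ d - 1 := by
  set f : Polynomial ℂ := Polynomial.X ^ (d - k * h) * rootsPoly h ^ k with hf
  have hm : f.Monic := (Polynomial.monic_X_pow _).mul ((monic_rootsPoly h).pow _)
  have hdeg : f.natDegree = d := by
    rw [hf, (Polynomial.monic_X_pow _).natDegree_mul ((monic_rootsPoly h).pow _),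
      Polynomial.natDegree_X_pow, (monic_rootsPoly h).natDegree_pow, natDegree_rootsPoly]
    omega
  have hmem := rootsPoly_mul_mem_gridIdeal (h := h) (g := g) (k := k) (i := k) (j := 0) (by omega)
    (Polynomial.X ^ (d - k * h)) 1
  rw [pow_zero, mul_one] at hmem
  refine ⟨_, hmem, ?_⟩
  have e : prodPoly f 1 - X 0 ^ d = prodPoly (f - Polynomial.X ^ d) 1 := by
    simp [prodPoly]
  rw [e]
  refine (totalDegree_prodPoly_le _ _).trans ?_
  rw [Polynomial.natDegree_one, add_zero]
  exact Nat.le_sub_one_of_lt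
    (Polynomial.IsMonicOfDegree.natDegree_sub_X_pow (by omega) ⟨hdeg, hm⟩)

lemma exists_gridIdeal_inf {g k n : ℕ} (h : ℕ) (hkg : k * g ≤ n) :
    ∃ v ∈ gridIdeal h g k, v.totalDegree ≤ n ∧ coeff (Finsupp.single 1 n) v ≠ 0 := by
  set f : Polynomial ℂ := Polynomial.X ^ (n - k * g) * rootsPoly g ^ k with hf
  have hm : f.Monic := (Polynomial.monic_X_pow _).mul ((monic_rootsPoly g).pow _)
  have hdeg : f.natDegree = n := by
    rw [hf, (Polynomial.monic_X_pow _).natDegree_mul ((monic_rootsPoly g).pow _),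
      Polynomial.natDegree_X_pow, (monic_rootsPoly g).natDegree_pow, natDegree_rootsPoly]
    omega
  have hmem := rootsPoly_mul_mem_gridIdeal (h := h) (g := g) (k := k) (i := 0) (j := k) (by omega)
    1 (Polynomial.X ^ (n - k * g))
  rw [pow_zero, mul_one] at hmem
  refine ⟨_, hmem, ?_, ?_⟩
  · refine (totalDegree_prodPoly_le _ _).trans ?_
    rw [← hf, hdeg, Polynomial.natDegree_one, zero_add]
  · rw [← hf, coeff_prodPoly]
    have := hm.coeff_natDegree
    rw [hdeg] at this
    simp [this]

/-- The exponents `(a, b)` with `a + b ≤ n`. -/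
def triangle (n : ℕ) : Finset (ℕ × ℕ) :=
  (Finset.range (n + 1) ×ˢ Finset.range (n + 1)).filter fun t => t.1 + t.2 ≤ n

lemma mem_triangle {n : ℕ} {t : ℕ × ℕ} : t ∈ triangle n ↔ t.1 + t.2 ≤ n := by
  simp only [triangle, Finset.mem_filter, Finset.mem_product, Finset.mem_range]
  omega

lemma card_triangle (n : ℕ) : (triangle n).card = (n + 1) * (n + 2) / 2 := by
  rw [Finset.card_eq_sum_card_fiberwise (f := fun t : ℕ × ℕ => t.1 + t.2)
    (t := Finset.range (n + 1)), ← sum_range_succ_eq]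
  · refine Finset.sum_congr rfl fun k hk => ?_
    rw [← Finset.Nat.card_antidiagonal k]
    congr 1
    ext t
    rw [Finset.mem_filter, mem_triangle, Finset.HasAntidiagonal.mem_antidiagonal]
    rw [Finset.mem_range] at hk
    omega
  · intro t ht
    have := mem_triangle.1 (Finset.mem_coe.1 ht)
    simp only [Finset.coe_range, Set.mem_Iio]
    omega

/-- The exponents `(a, b)` with `a + b ≤ c` whose `gridBasis` polynomial lies in the grid ideal. -/
def gridIndex (h g k c : ℕ) : Finset (ℕ × ℕ) :=
  (triangle c).filter fun t => k ≤ t.1 / h + t.2 / g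

lemma card_gridIndex {h g k c s : ℕ} (hk : 1 ≤ k) (hsg : s ≤ g) (hsh : s ≤ h)
    (hg : 1 ≤ g) (hh : 1 ≤ h) (hc : c + 2 * s < k * h + g) :
    (c + 1) * (c + 2) / 2 + s ^ 2 ≤ (gridIndex h g k c).card + h * g * (k * (k + 1) / 2) := by
  set M := (triangle c).filter fun t => ¬ k ≤ t.1 / h + t.2 / g with hM
  set B := (Finset.range s ×ˢ Finset.range s).image
    fun t : ℕ × ℕ => (k * h - 1 - t.1, g - 1 - t.2) with hB
  set N := (triangle (k - 1) ×ˢ (Finset.range h ×ˢ Finset.range g)).image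
    fun t : (ℕ × ℕ) × (ℕ × ℕ) => (t.1.1 * h + t.2.1, t.1.2 * g + t.2.2) with hN
  have hkh : h ≤ k * h := Nat.le_mul_of_pos_left _ hk
  have hkh' : (k - 1) * h + h = k * h := by
    obtain ⟨k, rfl⟩ := Nat.exists_eq_add_of_le hk
    rw [Nat.add_sub_cancel_left]
    ring
  have hNcard : N.card ≤ h * g * (k * (k + 1) / 2) := by
    refine Finset.card_image_le.trans ?_
    rw [Finset.card_product, Finset.card_product, card_triangle, Finset.card_range,
      Finset.card_range, mul_comm, show k - 1 + 1 = k by omega, show k - 1 + 2 = k + 1 by omega]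
  have hBcard : B.card = s ^ 2 := by
    rw [hB, Finset.card_image_of_injOn, Finset.card_product, Finset.card_range, sq]
    rintro ⟨a, b⟩ h1 ⟨a', b'⟩ h2 heq
    simp only [Finset.coe_product, Finset.coe_range, Set.mem_prod, Set.mem_Iio] at h1 h2
    simp only [Prod.mk.injEq] at heq ⊢
    omega
  have hmem : ∀ t : ℕ × ℕ, t.1 / h + t.2 / g < k → t ∈ N := by
    intro t ht
    refine Finset.mem_image.2 ⟨((t.1 / h, t.2 / g), (t.1 % h, t.2 % g)), ?_, ?_⟩
    · simp only [Finset.mem_product, mem_triangle, Finset.mem_range]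
      exact ⟨by omega, Nat.mod_lt _ hh, Nat.mod_lt _ hg⟩
    · exact Prod.ext (Nat.div_add_mod' _ _) (Nat.div_add_mod' _ _)
  have hMN : M ⊆ N := fun t ht => hmem t (not_le.1 (Finset.mem_filter.1 ht).2)
  have hBN : B ⊆ N := by
    intro t ht
    obtain ⟨u, hu, rfl⟩ := Finset.mem_image.1 ht
    simp only [Finset.mem_product, Finset.mem_range] at hu
    refine hmem _ ?_
    have h1 : (g - 1 - u.2) / g = 0 := Nat.div_eq_of_lt (by omega)
    have h2 : (k * h - 1 - u.1) / h < k := by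
      rw [Nat.div_lt_iff_lt_mul hh]
      omega
    simpa [h1] using h2
  have hdisj : Disjoint M B := by
    rw [Finset.disjoint_left]
    intro t ht htB
    obtain ⟨u, hu, rfl⟩ := Finset.mem_image.1 htB
    simp only [Finset.mem_product, Finset.mem_range] at hu
    have := mem_triangle.1 (Finset.mem_filter.1 ht).1
    simp only at this
    omega
  have h1 : M.card + s ^ 2 ≤ h * g * (k * (k + 1) / 2) := by
    rw [← hBcard, ← Finset.card_union_of_disjoint hdisj]
    exact (Finset.card_le_card (Finset.union_subset hMN hBN)).trans hNcard
  have h2 := Finset.card_filter_add_card_filter_not (s := triangle c)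
    (fun t : ℕ × ℕ => k ≤ t.1 / h + t.2 / g)
  rw [card_triangle] at h2
  change (gridIndex h g k c).card + M.card = _ at h2
  omega

/-- Existence of the curve when there are many points of equal multiplicity `k`. -/
theorem exists_curve_of_grid {r d m k h g : ℕ} (hd : m + 2 ≤ d) (hd3 : 3 ≤ d) {μ : Fin r → ℕ}
    (hμ : ∀ i, 1 ≤ μ i ∧ μ i ≤ m) (hk : 1 ≤ k) (hkh : k * h ≤ d - 2) (hgh : g ≤ h)
    (hr : h * g ≤ (Finset.univ.filter fun i => μ i = k).card)
    (hcount : ∑ i, μ i * (μ i + 1) / 2 <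
      (gridIndex h g k (d - m - 2)).card + h * g * (k * (k + 1) / 2)) :
    ∃ (P : Fin r → Proj2) (F : MvPolynomial (Fin 3) ℂ),
      Function.Injective P ∧ F ∈ homogeneousSubmodule (Fin 3) ℂ d ∧ Irreducible F ∧
      (∀ i, HasOrdinarySingularity (μ i) (P i) F) ∧ SmoothAwayFrom F P := by
  obtain ⟨⟨φ', hφ'⟩⟩ : Nonempty (Fin h × Fin g ↪ {i // μ i = k}) := by
    refine Function.Embedding.nonempty_of_card_le ?_
    rw [Fintype.card_prod, Fintype.card_fin, Fintype.card_fin, Fintype.card_subtype]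
    exact hr
  set φ : Fin h × Fin g → Fin r := fun t => φ' t with hφdef
  have hφ : Function.Injective φ := Subtype.val_injective.comp hφ'
  have hφk : ∀ t, μ (φ t) = k := fun t => (φ' t).2
  set S : Finset (Fin r) := (Finset.univ.image φ)ᶜ with hSdef
  have hmemS : ∀ i, i ∉ S ↔ ∃ t, φ t = i := by
    intro i
    simp [hSdef]
  have hkg : k * g ≤ d - 2 := (Nat.mul_le_mul_left k hgh).trans hkh
  obtain ⟨P', hint, hinj, hgen⟩ := exists_interpolating_points
    (τ := {t // t ∈ gridIndex h g k (d - m - 2)}) (I := gridIdeal h g k) (c := d - m - 2)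
    (e := d - 3) (m := m) (fun t => prodPoly (gridBasis h t.1.1) (gridBasis g t.1.2))
    ((linearIndependent_prodPoly (gridBasis h) (gridBasis g) (monic_gridBasis h)
      (monic_gridBasis g) (natDegree_gridBasis h) (natDegree_gridBasis g)).comp _
      Subtype.val_injective)
    (fun t => rootsPoly_mul_mem_gridIdeal (Finset.mem_filter.1 t.2).2 _ _)
    (fun t => by
      refine (totalDegree_prodPoly_le _ _).trans ?_
      rw [natDegree_gridBasis, natDegree_gridBasis]
      exact mem_triangle.1 (Finset.mem_filter.1 t.2).1)
    (by omega) μ S (fun i _ => hμ i) (by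
      rw [Fintype.card_coe]
      have h1 := Finset.sum_add_sum_compl (Finset.univ.image φ) fun i => μ i * (μ i + 1) / 2
      rw [Finset.sum_image fun a _ b _ hab => hφ hab] at h1
      simp only [hφk, Finset.sum_const, Finset.card_univ, Fintype.card_prod, Fintype.card_fin,
        smul_eq_mul] at h1
      rw [← hSdef] at h1
      omega)
  set Q : Fin r → Fin 2 → ℂ :=
    Function.extend φ (fun t => gridPoint (t.1 : ℕ) (t.2 : ℕ)) P' with hQ
  have hQφ : ∀ t, Q (φ t) = gridPoint (t.1 : ℕ) (t.2 : ℕ) := fun t => hφ.extend_apply _ _ t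
  have hQS : ∀ i ∈ S, Q i = P' i := by
    intro i hi
    refine Function.extend_apply' _ _ _ fun ht => ?_
    exact (hmemS i).2 ht hi
  have hne : ∀ i ∈ S, ∀ t, Q (φ t) ≠ Q i := by
    intro i hi t heq
    obtain ⟨u, hu, hu0⟩ := hgen i hi
    rw [← hQS i hi, ← heq, hQφ] at hu0
    exact hu0 (mem_fatIdeal_one.1
      (fatIdeal_anti _ hk (gridIdeal_le_fatIdeal t.1.2 t.2.2 hu)))
  have hQinj : Function.Injective Q := by
    intro i j hij
    by_cases hi : i ∈ S
    · by_cases hj : j ∈ S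
      · rw [hQS i hi, hQS j hj] at hij
        exact hinj hi hj hij
      · obtain ⟨t, rfl⟩ := (hmemS j).1 hj
        exact absurd hij.symm (hne i hi t)
    · obtain ⟨t, rfl⟩ := (hmemS i).1 hi
      by_cases hj : j ∈ S
      · exact absurd hij (hne j hj t)
      · obtain ⟨u, rfl⟩ := (hmemS j).1 hj
        rw [hQφ, hQφ] at hij
        have := gridPoint_injective (a₁ := ((t.1 : ℕ), (t.2 : ℕ)))
          (a₂ := ((u.1 : ℕ), (u.2 : ℕ))) hij
        simp only [Prod.mk.injEq, Fin.val_inj] at this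
        rw [Prod.ext this.1 this.2]
  refine exists_curve_of_interpolates hd3 (I := gridIdeal h g k) (S := S) hQinj
    (fun i => (hμ i).1) ?_ ?_ ?_ ?_ ?_ ?_
  · intro t
    obtain ⟨w, hw, hwd, hwt⟩ := hint t
    refine ⟨w, hw, hwd, fun i hi => ?_⟩
    rw [hQS i hi]
    exact hwt i hi
  · intro i hi
    obtain ⟨t, rfl⟩ := (hmemS i).1 hi
    rw [hQφ, hφk]
    exact gridIdeal_le_fatIdeal t.1.2 t.2.2
  · intro q hq
    refine exists_gridIdeal_eval_ne_zero hkh hkg fun i hi j hj => ?_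
    have := hq (φ (⟨i, hi⟩, ⟨j, hj⟩)) ((hmemS _).2 ⟨_, rfl⟩)
    rwa [hQφ] at this
  · intro i hi f hf
    obtain ⟨t, rfl⟩ := (hmemS i).1 hi
    rw [hQφ, hφk] at hf ⊢
    obtain ⟨v, hv, hvd, hvf⟩ := exists_gridIdeal_lead t.1.2 t.2.2 hgh k hf
    exact ⟨v, hv, by omega, hvf⟩
  · exact exists_gridIdeal_top g (by omega) (by omega)
  · exact exists_gridIdeal_inf h (by omega)

/-- Existence of the curve when there are few points. -/
theorem exists_curve_of_card_lt {r d m : ℕ} (hd : m + 2 ≤ d) (hd3 : 3 ≤ d) {μ : Fin r → ℕ}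
    (hμ : ∀ i, 1 ≤ μ i ∧ μ i ≤ m)
    (hcount : ∑ i, μ i * (μ i + 1) / 2 < (d - m - 2 + 1) * (d - m - 2 + 2) / 2) :
    ∃ (P : Fin r → Proj2) (F : MvPolynomial (Fin 3) ℂ),
      Function.Injective P ∧ F ∈ homogeneousSubmodule (Fin 3) ℂ d ∧ Irreducible F ∧
      (∀ i, HasOrdinarySingularity (μ i) (P i) F) ∧ SmoothAwayFrom F P := by
  obtain ⟨P, hint, hinj, -⟩ := exists_interpolating_points
    (τ := {t // t ∈ triangle (d - m - 2)}) (I := ⊤) (c := d - m - 2)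
    (e := d - 3) (m := m) (fun t => prodPoly (Polynomial.X ^ t.1.1) (Polynomial.X ^ t.1.2))
    ((linearIndependent_prodPoly (fun a => Polynomial.X ^ a) (fun a => Polynomial.X ^ a)
      Polynomial.monic_X_pow Polynomial.monic_X_pow Polynomial.natDegree_X_pow
      Polynomial.natDegree_X_pow).comp _ Subtype.val_injective)
    (fun t => Submodule.mem_top)
    (fun t => by
      refine (totalDegree_prodPoly_le _ _).trans ?_
      rw [Polynomial.natDegree_X_pow, Polynomial.natDegree_X_pow]
      exact mem_triangle.1 t.2)
    (by omega) μ Finset.univ (fun i _ => hμ i) (by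
      rwa [Fintype.card_coe, card_triangle])
  rw [Finset.coe_univ, Set.injOn_univ] at hinj
  refine exists_curve_of_interpolates hd3 (I := ⊤) hinj (fun i => (hμ i).1) hint
    (fun i hi => absurd (Finset.mem_univ i) hi) ?_ (fun i hi => absurd (Finset.mem_univ i) hi)
    ⟨X 0 ^ d, Submodule.mem_top, by simp⟩
    ⟨X 1 ^ (d - 1), Submodule.mem_top, by rw [totalDegree_X_pow], by simp [coeff_X_pow]⟩
  exact fun q _ => ⟨1, Submodule.mem_top, by simp, by simp⟩

lemma explicit_bound_growth {m : ℕ} (hm : 1 ≤ m) :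
    16 * m ^ 2 * (m + 1) ^ 2 * (m + 2) ≤ 2 * ((m + 2) * 38) ^ (2 ^ (m - 1)) := by
  obtain rfl | rfl | rfl | h4 : m = 1 ∨ m = 2 ∨ m = 3 ∨ 4 ≤ m := by omega
  · norm_num
  · norm_num
  · norm_num
  · have h1 : 2 ^ 3 ≤ 2 ^ (m - 1) := Nat.pow_le_pow_right (by norm_num) (by omega)
    have h2 : m ^ 2 ≤ (m + 2) ^ 2 := Nat.pow_le_pow_left (by omega) 2
    have h3 : (m + 1) ^ 2 ≤ (m + 2) ^ 2 := Nat.pow_le_pow_left (by omega) 2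
    calc 16 * m ^ 2 * (m + 1) ^ 2 * (m + 2)
        ≤ 16 * (m + 2) ^ 2 * (m + 2) ^ 2 * (m + 2) := by gcongr
      _ = 16 * (m + 2) ^ 5 := by ring
      _ ≤ (2 * 38 ^ 5) * (m + 2) ^ 5 := by gcongr; norm_num
      _ = 2 * ((m + 2) * 38) ^ 5 := by ring
      _ ≤ 2 * ((m + 2) * 38) ^ (2 ^ (m - 1)) := by
        gcongr
        · omega
        · omega

/-- Some multiplicity `k` carries at least the average share of the conditions. -/
lemma exists_frequent_multiplicity {r m : ℕ} (hm : 1 ≤ m) {μ : Fin r → ℕ}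
    (hμ : ∀ i, 1 ≤ μ i ∧ μ i ≤ m) :
    ∃ k, 1 ≤ k ∧ k ≤ m ∧ ∑ i, μ i * (μ i + 1) / 2 ≤
      m * ((Finset.univ.filter fun i => μ i = k).card * (k * (k + 1) / 2)) := by
  by_contra! hlt
  have h1 := Finset.sum_fiberwise_of_maps_to (s := Finset.univ) (t := Finset.Icc 1 m) (g := μ)
    (fun i _ => Finset.mem_Icc.2 (hμ i)) (fun i => μ i * (μ i + 1) / 2)
  have h2 : ∀ k ∈ Finset.Icc 1 m, ∑ i with μ i = k, μ i * (μ i + 1) / 2 =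
      (Finset.univ.filter fun i => μ i = k).card * (k * (k + 1) / 2) := by
    intro k _
    rw [Finset.sum_congr rfl (g := fun _ => k * (k + 1) / 2), Finset.sum_const, smul_eq_mul]
    intro i hi
    rw [(Finset.mem_filter.1 hi).2]
  rw [Finset.sum_congr rfl h2] at h1
  have h3 := Finset.sum_lt_sum_of_nonempty (s := Finset.Icc 1 m) ⟨1, Finset.mem_Icc.2 ⟨le_rfl, hm⟩⟩
    fun k hk => hlt k (Finset.mem_Icc.1 hk).1 (Finset.mem_Icc.1 hk).2
  rw [← Finset.mul_sum, h1] at h3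
  simp at h3

/-- Existence of the curve for degrees that are large compared to the multiplicities. -/
theorem exists_curve_of_large_degree {r d m : ℕ} (hm : 1 ≤ m)
    (hd : 16 * m ^ 2 * (m + 1) ^ 2 * (m + 2) ≤ d) {μ : Fin r → ℕ}
    (hμ : ∀ i, 1 ≤ μ i ∧ μ i ≤ m) (hR : 2 * ∑ i, μ i * (μ i + 1) / 2 ≤ d * (d + 3)) :
    ∃ (P : Fin r → Proj2) (F : MvPolynomial (Fin 3) ℂ),
      Function.Injective P ∧ F ∈ homogeneousSubmodule (Fin 3) ℂ d ∧ Irreducible F ∧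
      (∀ i, HasOrdinarySingularity (μ i) (P i) F) ∧ SmoothAwayFrom F P := by
  have hdm : 4 * m ^ 2 + 8 * m ≤ d := by
    refine le_trans ?_ hd
    have h1 : 2 ^ 2 ≤ (m + 1) ^ 2 := Nat.pow_le_pow_left (by omega) 2
    calc 4 * m ^ 2 + 8 * m ≤ 16 * m ^ 2 * 2 ^ 2 * 3 := by nlinarith
      _ ≤ _ := by gcongr; omega
  have hmm : m ≤ m ^ 2 := Nat.le_self_pow (by norm_num) m
  by_cases hA : ∑ i, μ i * (μ i + 1) / 2 < (d - m - 2 + 1) * (d - m - 2 + 2) / 2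
  · exact exists_curve_of_card_lt (by omega) (by omega) hμ hA
  obtain ⟨k, hk1, hkm, hk⟩ := exists_frequent_multiplicity hm hμ
  set R := ∑ i, μ i * (μ i + 1) / 2 with hRdef
  set n := (Finset.univ.filter fun i => μ i = k).card with hn
  obtain ⟨e, he⟩ : ∃ e, d = e + 2 * m + 1 := ⟨d - 2 * m - 1, by omega⟩
  set s := e / (2 * m * (m + 1)) with hs
  set h := (d - 2) / k with hh
  have hMpos : 0 < 2 * m * (m + 1) := by positivity
  have hs1 : 2 * m * (m + 1) * s ≤ e := Nat.mul_div_le _ _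
  have hs2 : e < 2 * m * (m + 1) * (s + 1) := Nat.lt_mul_div_succ _ hMpos
  have hkh : k * h ≤ d - 2 := Nat.mul_div_le _ _
  have hkh2 : d - 2 < k * (h + 1) := Nat.lt_mul_div_succ _ hk1
  have hsd : d ≤ 4 * m * (m + 1) * s := by nlinarith
  have hs_pos : 1 ≤ s := by
    rcases Nat.eq_zero_or_pos s with h0 | h0
    · rw [h0] at hsd
      omega
    · exact h0
  have hgh : 2 * s ≤ h := by
    rw [hh, Nat.le_div_iff_mul_le hk1]
    have : 2 * s * k ≤ 2 * m * (m + 1) * s := by nlinarith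
    omega
  have hcd : d - m - 2 + 1 = e + m := by omega
  have hcd2 : d - m - 2 + 2 = e + m + 1 := by omega
  have hcount := card_gridIndex (h := h) (g := 2 * s) (k := k) (c := d - m - 2) (s := s) hk1
    (by omega) (by omega) (by omega) (by omega) (by rw [mul_add, mul_one] at hkh2; omega)
  have heven : 2 * ((d - m - 2 + 1) * (d - m - 2 + 2) / 2) = (e + m) * (e + m + 1) := by
    rw [hcd, hcd2]
    exact Nat.mul_div_cancel' (Nat.even_mul_succ_self _).two_dvd
  have hevenk : 2 * (k * (k + 1) / 2) = k * (k + 1) :=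
    Nat.mul_div_cancel' (Nat.even_mul_succ_self _).two_dvd
  have hs_sq : (m + 2) * d ≤ s ^ 2 := by
    have h1 : d * d ≤ (4 * m * (m + 1) * s) * (4 * m * (m + 1) * s) := Nat.mul_le_mul hsd hsd
    have h2 : (16 * m ^ 2 * (m + 1) ^ 2) * ((m + 2) * d) ≤ (16 * m ^ 2 * (m + 1) ^ 2) * s ^ 2 := by
      calc _ = (16 * m ^ 2 * (m + 1) ^ 2 * (m + 2)) * d := by ring
        _ ≤ d * d := Nat.mul_le_mul_right _ hd
        _ ≤ _ := h1
        _ = _ := by ring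
    exact Nat.le_of_mul_le_mul_left h2 (by positivity)
  refine exists_curve_of_grid (m := m) (k := k) (h := h) (g := 2 * s) (by omega) (by omega) hμ
    hk1 hkh hgh ?_ ?_
  · have h1 : (e + m) * (e + m + 1) ≤ m * (n * (k * (k + 1))) := by
      calc (e + m) * (e + m + 1) ≤ 2 * R := by omega
        _ ≤ 2 * (m * (n * (k * (k + 1) / 2))) := by omega
        _ = m * (n * (2 * (k * (k + 1) / 2))) := by ring
        _ = _ := by rw [hevenk]
    have h2 : m * k * (k + 1) * (h * (2 * s)) ≤ m * k * (k + 1) * n := by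
      calc m * k * (k + 1) * (h * (2 * s)) = (k * h) * (2 * m * (k + 1) * s) := by ring
        _ ≤ d * (2 * m * (m + 1) * s) := by gcongr; omega
        _ ≤ d * e := by gcongr
        _ ≤ (e + m) * (e + m + 1) := by rw [he]; nlinarith
        _ ≤ _ := h1
        _ = _ := by ring
    exact Nat.le_of_mul_le_mul_left h2 (by positivity)
  · have h1 : d * (d + 3) < (e + m) * (e + m + 1) + 2 * ((m + 2) * d) := by
      have h2 : d * (d + 3) + m * (m + 1) = (e + m) * (e + m + 1) + 2 * ((m + 2) * d) := by
        rw [he]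
        ring
      have h3 : 0 < m * (m + 1) := by positivity
      omega
    omega

/-- The explicit bound `D(m) = 2·((m+2)·38)^(2^(m−1))` works in the
existence theorem for irreducible plane curves of degree `d` with `r` ordinary singularities
of multiplicities `m₁, …, m_r` in general position. -/
theorem existence_with_explicit_bound :
    ∀ m : ℕ, 1 ≤ m → ∀ d : ℕ, 2 * ((m + 2) * 38) ^ (2 ^ (m - 1)) ≤ d → ∀ r : ℕ, 1 ≤ r →
      ∀ mi : Fin r → ℕ, (∀ i, 1 ≤ mi i ∧ mi i ≤ m) →
        1 ≤ ((d : ℤ) + 1) * ((d : ℤ) + 2) / 2 - ∑ i, (mi i : ℤ) * ((mi i : ℤ) + 1) / 2 →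
        ∃ (P : Fin r → Proj2) (F : MvPolynomial (Fin 3) ℂ),
          Function.Injective P ∧
          F ∈ homogeneousSubmodule (Fin 3) ℂ d ∧
          Irreducible F ∧
          (∀ i, HasOrdinarySingularity (mi i) (P i) F) ∧
          SmoothAwayFrom F P := by
  intro m hm d hd r _ mi hmi hsum
  refine exists_curve_of_large_degree hm ((explicit_bound_growth hm).trans hd) hmi ?_
  have h1 : ((∑ i, mi i * (mi i + 1) / 2 : ℕ) : ℤ) = ∑ i, (mi i : ℤ) * ((mi i : ℤ) + 1) / 2 := by
    push_cast
    rfl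
  have h2 : (d + 1 : ℤ) * (d + 2) = d * (d + 3) + 2 := by ring
  rw [← h1, h2] at hsum
  zify
  push_cast at hsum ⊢
  omega

end
end

section
/- Let d ≥ 1, l ≥ 1, c, and n_1, …, n_r, m_1, …, m_r be integers with d = l·c and m_i = l·n_i for all i. Suppose that d² = Σ_{i=1}^r m_i², that (d+1)(d+2)/2 − Σ_{i=1}^r m_i(m_i+1)/2 ≥ d + 1, and that (c−1)(c−2)/2 − Σ_{i=1}^r n_i(n_i−1)/2 ≥ 0. Then l ≥ d. -/
theorem two_mul_sum_mul_add_one_ediv_two {ι : Type*} (s : Finset ι) (f : ι → ℤ) :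
    2 * ∑ i ∈ s, f i * (f i + 1) / 2 = ∑ i ∈ s, f i ^ 2 + ∑ i ∈ s, f i := by
  rw [Finset.mul_sum, ← Finset.sum_add_distrib]
  refine Finset.sum_congr rfl fun i _ => ?_
  rw [Int.mul_ediv_cancel' (Int.even_mul_succ_self (f i)).two_dvd]
  ring

theorem two_mul_sum_mul_sub_one_ediv_two {ι : Type*} (s : Finset ι) (f : ι → ℤ) :
    2 * ∑ i ∈ s, f i * (f i - 1) / 2 = ∑ i ∈ s, f i ^ 2 - ∑ i ∈ s, f i := by
  rw [Finset.mul_sum, ← Finset.sum_sub_distrib]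
  refine Finset.sum_congr rfl fun i _ => ?_
  rw [Int.mul_ediv_cancel' (Int.even_mul_pred_self (f i)).two_dvd]
  ring

/-- If `d = l·c ≥ 1`, `mᵢ = l·nᵢ`, `d² = Σ mᵢ²`, `χ(𝐝) ≥ d + 1` and
`g(c; n₁, …, n_r) ≥ 0`, then `l ≥ d`. This is the numerical lemma showing that a smooth
member of a system with `χ(𝐝) ≥ d+1` cannot split into `l` numerically equal components
unless `l = d`. -/
theorem numerically_equal_components_lemma
    (r : ℕ) (d l c : ℤ) (n m : Fin r → ℤ)
    (hd1 : 1 ≤ d) (hl1 : 1 ≤ l)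
    (hdc : d = l * c) (hmn : ∀ i, m i = l * n i)
    (hsq : d ^ 2 = ∑ i, (m i) ^ 2)
    (hchi : d + 1 ≤ (d + 1) * (d + 2) / 2 - ∑ i, m i * (m i + 1) / 2)
    (hg : 0 ≤ (c - 1) * (c - 2) / 2 - ∑ i, n i * (n i - 1) / 2) :
    d ≤ l := by
  have hl : 0 < l := by lia
  have hsum_m : ∑ i, m i = l * ∑ i, n i := by simp only [hmn, Finset.mul_sum]
  have hsum_sq : c ^ 2 = ∑ i, n i ^ 2 := by
    refine mul_left_cancel₀ (pow_ne_zero 2 hl.ne') ?_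
    rw [← mul_pow, ← hdc, hsq, Finset.mul_sum]
    simp only [hmn, mul_pow]
  have hm := two_mul_sum_mul_add_one_ediv_two Finset.univ m
  have hn := two_mul_sum_mul_sub_one_ediv_two Finset.univ n
  have hd2 := Int.ediv_mul_le ((d + 1) * (d + 2)) (two_ne_zero (α := ℤ))
  have hc2 := Int.ediv_mul_le ((c - 1) * (c - 2)) (two_ne_zero (α := ℤ))
  have hle : ∑ i, n i ≤ c := by
    refine le_of_mul_le_mul_left ?_ hl
    rw [← hsum_m, ← hdc]
    linarith
  have hge : 3 * c - 2 ≤ ∑ i, n i := by linarith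
  have hc : c ≤ 1 := by lia
  rw [hdc]
  exact mul_le_of_le_one_right hl.le hc
end

section
/- Let m ≥ 1, a, d, t ≥ 0, r ≥ 0, α be integers with a ≥ 4m, d ≥ 2am, 0 ≤ α ≤ t, and set g = (a−1)(a−2)/2. Let n_1, …, n_t be integers with 0 ≤ n_i ≤ m−1 and m_1, …, m_r integers with 1 ≤ m_j ≤ m. Assume that (d+1)(d+2)/2 − Σ_{i=1}^t n_i(n_i+1)/2 − Σ_{j=1}^r m_j(m_j+1)/2 = α and that d·a + 1 − g − Σ_{i=1}^t n_i − α ≥ 0. Then there exists an integer s with 0 ≤ s ≤ r such that, setting β = d·a + 1 − g − α − Σ_{i=1}^t n_i − Σ_{j=1}^s m_j, one has 0 ≤ β ≤ m−1 and s + β ≤ r. -/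
open Finset

/-- A sum of triangular numbers `xᵢ(xᵢ+1)/2` with `0 ≤ xᵢ ≤ c` is at most `(c+1)/2` times `∑ xᵢ`. -/
lemma two_mul_sum_triangular_le {ι : Type*} (S : Finset ι) (f : ι → ℤ) (c : ℤ)
    (h : ∀ i ∈ S, 0 ≤ f i ∧ f i ≤ c) :
    2 * ∑ i ∈ S, f i * (f i + 1) / 2 ≤ (c + 1) * ∑ i ∈ S, f i := by
  rw [mul_sum, mul_sum]
  refine sum_le_sum fun i hi => ?_
  obtain ⟨h0, hc⟩ := h i hi
  have hdiv : 2 * (f i * (f i + 1) / 2) ≤ f i * (f i + 1) := Int.mul_ediv_self_le (by norm_num)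
  nlinarith

/-- Arithmetic claim from the proof of the vanishing corollary: one can
choose `s ≤ r` specialized points so that the residual count
`β = da + 1 − g − α − Σᵢ nᵢ − Σ_{j<s} mⱼ` lies in `[0, m−1]` and `s + β ≤ r`, where
`g = (a−1)(a−2)/2`. -/
theorem exists_adjusting_s
    (m a d α : ℤ) (t r : ℕ)
    (hm : 1 ≤ m) (ha : 4 * m ≤ a) (hd : 2 * a * m ≤ d)
    (hα0 : 0 ≤ α) (hαt : α ≤ (t : ℤ))
    (n : ℕ → ℤ) (hn : ∀ i < t, 0 ≤ n i ∧ n i ≤ m - 1)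
    (mm : ℕ → ℤ) (hmm : ∀ j < r, 1 ≤ mm j ∧ mm j ≤ m)
    (hchi : (d + 1) * (d + 2) / 2 - (∑ i ∈ range t, n i * (n i + 1) / 2)
        - (∑ j ∈ range r, mm j * (mm j + 1) / 2) = α)
    (hpos : 0 ≤ d * a + 1 - (a - 1) * (a - 2) / 2 - (∑ i ∈ range t, n i) - α) :
    ∃ s : ℕ, s ≤ r ∧
      0 ≤ d * a + 1 - (a - 1) * (a - 2) / 2 - α - (∑ i ∈ range t, n i)
        - (∑ j ∈ range s, mm j) ∧
      d * a + 1 - (a - 1) * (a - 2) / 2 - α - (∑ i ∈ range t, n i)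
        - (∑ j ∈ range s, mm j) ≤ m - 1 ∧
      (s : ℤ) + (d * a + 1 - (a - 1) * (a - 2) / 2 - α - (∑ i ∈ range t, n i)
        - (∑ j ∈ range s, mm j)) ≤ (r : ℤ) := by
  classical
  set g := (a - 1) * (a - 2) / 2 with hg
  set N := ∑ i ∈ range t, n i
  set B := d * a + 1 - g - α - N with hB
  have hB0 : 0 ≤ B := by linarith
  let P : ℕ → Prop := fun k => ∑ j ∈ range k, mm j ≤ B
  set s := Nat.findGreatest P r
  have hsr : s ≤ r := Nat.findGreatest_le r
  have hPs : ∑ j ∈ range s, mm j ≤ B :=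
    Nat.findGreatest_spec (P := P) (Nat.zero_le r) (by simpa [P] using hB0)
  have hN0 : 0 ≤ N := sum_nonneg fun i hi => (hn i (mem_range.mp hi)).1
  have hnsum := two_mul_sum_triangular_le (range t) n (m - 1) fun i hi => hn i (mem_range.mp hi)
  have hhead := two_mul_sum_triangular_le (range s) mm m fun j hj => by
    have := hmm j ((mem_range.mp hj).trans_le hsr)
    exact ⟨by linarith, this.2⟩
  have htail := two_mul_sum_triangular_le (Ico s r) mm m fun j hj => by
    have := hmm j (mem_Ico.mp hj).2
    exact ⟨by linarith, this.2⟩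
  have htail_le : ∑ j ∈ Ico s r, mm j ≤ ((r : ℤ) - s) * m := by
    have := sum_le_card_nsmul (Ico s r) mm m fun j hj => (hmm j (mem_Ico.mp hj).2).2
    simpa [Nat.cast_sub hsr] using this
  have hsplit := sum_range_add_sum_Ico (fun j => mm j * (mm j + 1) / 2) hsr
  have hg_lower : 8 * m ^ 2 - 6 * m + 1 ≤ g := by
    rw [hg, Int.le_ediv_iff_mul_le (by norm_num)]
    nlinarith
  have hd_half : (d + 1) * (d + 2) ≤ 2 * ((d + 1) * (d + 2) / 2) + 1 := by omega
  have htotal : (d + 1) * (d + 2) - 1 ≤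
      (m + 1) * (d * a + 1 - g) + (m + 1) * (((r : ℤ) - s) * m) := by
    have h1 : (m + 1) * ∑ j ∈ range s, mm j ≤ (m + 1) * B :=
      mul_le_mul_of_nonneg_left hPs (by linarith)
    have h2 : (m + 1) * ∑ j ∈ Ico s r, mm j ≤ (m + 1) * (((r : ℤ) - s) * m) :=
      mul_le_mul_of_nonneg_left htail_le (by linarith)
    have h3 : (m + 1) * (d * a + 1 - g) = (m + 1) * B + (m + 1) * N + (m + 1) * α := by
      rw [hB]; ring
    have h4 : 0 ≤ (m - 1) * α := mul_nonneg (by linarith) hα0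
    linarith
  have hd0 : 0 ≤ d := by nlinarith
  have hda : (m + 1) * (d * a) ≤ d * d := by
    have : (m + 1) * a ≤ d := by nlinarith
    nlinarith
  have hrest : m ≤ (r : ℤ) - s := by
    have h1 : (m + 1) * (8 * m ^ 2 - 6 * m + 1) ≤ (m + 1) * g :=
      mul_le_mul_of_nonneg_left hg_lower (by linarith)
    by_contra! hlt
    have h2 : (m + 1) * (((r : ℤ) - s) * m) ≤ (m + 1) * (m * m) := by gcongr
    nlinarith [mul_nonneg (sub_nonneg.mpr hm) (sq_nonneg m)]
  have hlt : s < r := by omega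
  have hnext : B < ∑ j ∈ range (s + 1), mm j :=
    not_le.mp (Nat.findGreatest_is_greatest (P := P) (Nat.lt_succ_self s) hlt)
  rw [sum_range_succ] at hnext
  have hms := (hmm s hlt).2
  exact ⟨s, hsr, by linarith, by linarith, by linarith⟩
end

section
/- Let m ≥ 1 and a, d, r be integers with a ≥ 4m, d ≥ a(2m+1), r ≥ 1, and set g = (a−1)(a−2)/2. Let m_1, …, m_r be integers with 1 ≤ m_i ≤ m and suppose (d+1)(d+2)/2 − Σ_{i=1}^r m_i(m_i+1)/2 = 1. Then there exists an integer s with 1 ≤ s ≤ r such that −d + a − m ≤ d·a − Σ_{i=1}^s m_i + 1 − g ≤ −d + a − 1; moreover any such s satisfies 2m·s ≥ 2d·a − a². -/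
open Finset

/-- A sequence starting at `0`, with the first `r` steps at most `m`, that reaches the positive
level `T` by time `r` overshoots it by less than `m` when it first gets there. -/
lemma exists_first_passage {f : ℕ → ℤ} {m T : ℤ} {r : ℕ} (hf : f 0 = 0)
    (hstep : ∀ i < r, f (i + 1) ≤ f i + m) (hT : 0 < T) (hr : T ≤ f r) :
    ∃ s : ℕ, 1 ≤ s ∧ s ≤ r ∧ T ≤ f s ∧ f s ≤ T + m - 1 := by
  induction r with
  | zero => omega
  | succ n ih =>
    by_cases hn : T ≤ f n
    · obtain ⟨s, h1, h2, h3⟩ := ih (fun i hi => hstep i (by omega)) hn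
      exact ⟨s, h1, by omega, h3⟩
    · have := hstep n (by omega)
      exact ⟨n + 1, by omega, le_rfl, hr, by omega⟩

lemma two_mul_sum_mul_add_one_div_two_le {mm : ℕ → ℤ} {m : ℤ} {r : ℕ}
    (hmm : ∀ i < r, 1 ≤ mm i ∧ mm i ≤ m) :
    2 * ∑ i ∈ range r, mm i * (mm i + 1) / 2 ≤ (m + 1) * ∑ i ∈ range r, mm i := by
  rw [mul_sum, mul_sum]
  refine sum_le_sum fun i hi => ?_
  obtain ⟨h1, h2⟩ := hmm i (mem_range.mp hi)
  have : 2 * (mm i * (mm i + 1) / 2) ≤ mm i * (mm i + 1) := Int.mul_ediv_self_le two_ne_zero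
  nlinarith

/-- Choice of the number `s` of points to specialize onto the auxiliary
generic curve of degree `a` (of genus `g = (a−1)(a−2)/2`) in the proof of the main theorem:
if `χ(𝐝) = 1` then there is `1 ≤ s ≤ r` with
`−d + a − m ≤ da − Σ_{i<s} mᵢ + 1 − g ≤ −d + a − 1`, and any such `s` satisfies
`2ms ≥ 2da − a²`. -/
theorem choice_of_specialized_points
    (m a d : ℤ) (r : ℕ)
    (hm : 1 ≤ m) (ha : 4 * m ≤ a) (hd : a * (2 * m + 1) ≤ d) (hr : 1 ≤ r)
    (mm : ℕ → ℤ) (hmm : ∀ i < r, 1 ≤ mm i ∧ mm i ≤ m)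
    (hchi : (d + 1) * (d + 2) / 2 - (∑ i ∈ range r, mm i * (mm i + 1) / 2) = 1) :
    (∃ s : ℕ, 1 ≤ s ∧ s ≤ r ∧
      -d + a - m ≤ d * a - (∑ i ∈ range s, mm i) + 1 - (a - 1) * (a - 2) / 2 ∧
      d * a - (∑ i ∈ range s, mm i) + 1 - (a - 1) * (a - 2) / 2 ≤ -d + a - 1) ∧
    ∀ s : ℕ, 1 ≤ s → s ≤ r →
      -d + a - m ≤ d * a - (∑ i ∈ range s, mm i) + 1 - (a - 1) * (a - 2) / 2 →
      d * a - (∑ i ∈ range s, mm i) + 1 - (a - 1) * (a - 2) / 2 ≤ -d + a - 1 →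
      2 * d * a - a ^ 2 ≤ 2 * m * (s : ℤ) := by
  have hgenus : 2 * ((a - 1) * (a - 2) / 2) = (a - 1) * (a - 2) := by
    have h := (Int.even_mul_succ_self (a - 2)).two_dvd
    rw [mul_comm, show a - 2 + 1 = a - 1 by ring] at h
    exact Int.mul_ediv_cancel' h
  have hdeg : 2 * ((d + 1) * (d + 2) / 2) = (d + 1) * (d + 2) := by
    have h := (Int.even_mul_succ_self (d + 1)).two_dvd
    rw [show d + 1 + 1 = d + 2 by ring] at h
    exact Int.mul_ediv_cancel' h
  generalize (a - 1) * (a - 2) / 2 = g at *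
  have had : 3 * a ≤ d := by nlinarith
  have hsum : ∀ s ≤ r, ∑ i ∈ range s, mm i ≤ m * s := fun s hs => by
    have h := sum_le_card_nsmul (range s) mm m fun i hi =>
      (hmm i (by have := mem_range.mp hi; omega)).2
    simpa [mul_comm] using h
  constructor
  · have hweight := two_mul_sum_mul_add_one_div_two_le hmm
    have htotal : d * (d + 3) ≤ (m + 1) * ∑ i ∈ range r, mm i := by nlinarith
    have hpos : 0 < d * a + d - a + 2 - g := by nlinarith
    have hupper : d * a + d - a + 2 - g ≤ d * a + d := by nlinarith
    have hdd : d * (a * (2 * m + 1)) ≤ d * d := mul_le_mul_of_nonneg_left hd (by omega)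
    have hdm : 0 ≤ d * (m * (a - 1)) :=
      mul_nonneg (by omega) (mul_nonneg (by omega) (by omega))
    have hreach : d * a + d - a + 2 - g ≤ ∑ i ∈ range r, mm i := by
      refine hupper.trans (le_of_mul_le_mul_left (le_trans ?_ htotal) (by omega : 0 < m + 1))
      nlinarith
    obtain ⟨s, h1, h2, h3, h4⟩ := exists_first_passage (f := fun s => ∑ i ∈ range s, mm i)
      (m := m) (by simp) (fun i hi => by
        simp only [sum_range_succ]
        linarith [(hmm i hi).2]) hpos hreach
    exact ⟨s, h1, h2, by linarith, by linarith⟩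
  · intro s _ hs _ h
    have := hsum s hs
    nlinarith
end
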